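/- arXiv:2102.09086 — 2 statements merged into one kernel-verified Lean document; each statement's English description precedes it below -/
import Mathlib

section
/- Let D = (μ, η) be the data distribution over ℝ × {±1} where μ is the uniform distribution over [0,1] and η(x) = x, with ρ the Euclidean metric. Suppose (k_n) is a sequence of positive integers with k_n = O(log n). Then the k_n-nearest neighbor classifier is not neighborhood consistent with respect to D: there exist 0 < ε, κ < 1 such that for infinitely many n, with probability at least 1/2 over S ∼ D^n, the astuteness A_{V^κ}(f_n, D) of the learned classifier f_n is less than A(g, D) − ε. -/
open MeasureTheory Metric Set Filter Topology
open scoped ENNReal Classical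

noncomputable section

/-- The real value of a `Bool` label: `true ↦ +1`, `false ↦ -1`. -/
def labelVal (b : Bool) : ℝ := if b then 1 else -1

abbrev Eucl (d : ℕ) : Type := EuclideanSpace ℝ (Fin d)

section BasicDefs

variable {E : Type*} [MeasurableSpace E]

/-- The joint distribution on instance-label pairs determined by the marginal `μ`
and the regression function `η` (label `+1` with probability `η x`). -/
def jointD (μ : Measure E) (η : E → ℝ) : Measure (E × Bool) :=
  μ.bind fun x =>
    ENNReal.ofReal (η x) • Measure.dirac (x, true) +
      ENNReal.ofReal (1 - η x) • Measure.dirac (x, false)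

/-- The distribution of an i.i.d. sample of size `n` from `D = (μ, η)`. -/
def sampleD (μ : Measure E) (η : E → ℝ) (n : ℕ) : Measure (Fin n → E × Bool) :=
  Measure.pi fun _ => jointD μ η

/-- The accuracy `A(f, D) = P_{(x,y) ∼ D}[f x = y]`. -/
def accuracy (μ : Measure E) (η : E → ℝ) (f : E → Bool) : ℝ :=
  (jointD μ η {p | f p.1 = p.2}).toReal

/-- The astuteness `A_U(f, D) = P_{(x,y) ∼ D}[f x' = y for all x' ∈ U x]`. -/
def astuteness (μ : Measure E) (η : E → ℝ) (U : E → Set E) (f : E → Bool) : ℝ :=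
  (jointD μ η {p | ∀ x' ∈ U p.1, f x' = p.2}).toReal

/-- The Bayes optimal classifier: `+1` iff `η x ≥ 1/2`. -/
def bayes (η : E → ℝ) : E → Bool := fun x => if (1/2 : ℝ) ≤ η x then true else false

end BasicDefs

section MetricDefs

variable {E : Type*} [MetricSpace E]

/-- The neighborhood preserving Bayes optimal classifier:
`+1` at `x` iff `ρ(x, μ⁺) ≤ ρ(x, μ⁻)`. -/
def gNeighbor (η : E → ℝ) : E → Bool := fun x =>
  if infDist x {z | (1/2 : ℝ) < η z} ≤ infDist x {z | η z < (1/2 : ℝ)} then true else false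

/-- The neighborhood preserving robustness region `V_x`. -/
def nbhdRegion (η : E → ℝ) (x : E) : Set E :=
  if (1/2 : ℝ) < η x then {x' | dist x x' < infDist x' {z | η z ≤ (1/2 : ℝ)}}
  else if η x < (1/2 : ℝ) then {x' | dist x x' < infDist x' {z | (1/2 : ℝ) ≤ η z}}
  else {x}

/-- The partial neighborhood preserving robustness region `V_x^κ`. -/
def nbhdRegionK (η : E → ℝ) (κ : ℝ) (x : E) : Set E :=
  if (1/2 : ℝ) < η x then {x' | dist x x' < κ * infDist x' {z | η z ≤ (1/2 : ℝ)}}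
  else if η x < (1/2 : ℝ) then {x' | dist x x' < κ * infDist x' {z | (1/2 : ℝ) ≤ η z}}
  else {x}

variable [MeasurableSpace E]

/-- The support of a measure: all points whose balls all have positive mass. -/
def msupport (μ : Measure E) : Set E := {x | ∀ r > 0, 0 < μ (Metric.ball x r)}

/-- `D⁺`: points of the support where `η > 1/2`. -/
def Dplus (μ : Measure E) (η : E → ℝ) : Set E := {x | x ∈ msupport μ ∧ (1/2 : ℝ) < η x}

/-- `D⁻`: points of the support where `η < 1/2`. -/
def Dminus (μ : Measure E) (η : E → ℝ) : Set E := {x | x ∈ msupport μ ∧ η x < (1/2 : ℝ)}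

/-- `D_{1/2}`: points of the support where `η = 1/2`. -/
def Dhalf (μ : Measure E) (η : E → ℝ) : Set E := {x | x ∈ msupport μ ∧ η x = (1/2 : ℝ)}

/-- The partial neighborhood preserving robustness region `V_x^κ`, support version. -/
def nbhdRegionKSupp (μ : Measure E) (η : E → ℝ) (κ : ℝ) (x : E) : Set E :=
  if x ∈ Dplus μ η then {x' | dist x x' < κ * infDist x' (Dminus μ η ∪ Dhalf μ η)}
  else if x ∈ Dminus μ η then {x' | dist x x' < κ * infDist x' (Dplus μ η ∪ Dhalf μ η)}
  else {x}

/-- The probability radius `r_p(x) = inf {r : μ(B(x,r)) ≥ p}`. -/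
def probRadius (μ : Measure E) (p : ℝ) (x : E) : ℝ :=
  sInf {r : ℝ | ENNReal.ofReal p ≤ μ (closedBall x r)}

/-- `r_p^ε(x) = sup {r : μ(B(x,r)) − μ(B(x,r_p(x))) ≤ ε}`. -/
def probRadiusEps (μ : Measure E) (p ε : ℝ) (x : E) : ℝ :=
  sSup {r : ℝ | (μ (closedBall x r)).toReal - (μ (closedBall x (probRadius μ p x))).toReal ≤ ε}

/-- `x` is `(p, Δ)`-covered: for all `x' ∈ U x` and all
`x'' ∈ B(x', r_p(x')) ∩ supp(μ)`, `η x'' > 1/2 + Δ`. -/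
def Covered (μ : Measure E) (η : E → ℝ) (U : E → Set E) (p Δ : ℝ) (x : E) : Prop :=
  ∀ x' ∈ U x, ∀ x'' ∈ closedBall x' (probRadius μ p x') ∩ msupport μ, 1/2 + Δ < η x''

end MetricDefs

/-- A weight function: for each sample of instances it produces nonnegative
weights summing to one, depending only on the instances. -/
structure WeightFn (E : Type*) where
  w : (n : ℕ) → (Fin n → E) → Fin n → E → ℝ
  nonneg : ∀ n xs i x, 0 ≤ w n xs i x
  le_one : ∀ n xs i x, w n xs i x ≤ 1
  sum_one : ∀ (n : ℕ) (xs : Fin n → E) (x : E), 0 < n → ∑ i, w n xs i x = 1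

/-- The classifier learned by a weight function from the sample `S`:
`+1` iff `∑ i, w_i(x) y_i > 0`. -/
def WeightFn.classify {E : Type*} (W : WeightFn E) {n : ℕ} (S : Fin n → E × Bool) : E → Bool :=
  fun x => if 0 < ∑ i, W.w n (fun j => (S j).1) i x * labelVal (S i).2 then true else false

/-- The splitting number of a family of weights on a fixed sample: the number of
distinct sets `{i : ρ(x, x_i) ≤ α, w_i(x) ≥ β}`. -/
def splitNumRaw {E : Type*} [MetricSpace E] {n : ℕ} (xs : Fin n → E) (w : Fin n → E → ℝ) : ℕ :=
  Set.ncard {T : Set (Fin n) | ∃ (x : E) (α β : ℝ), 0 ≤ α ∧ β ∈ Icc (0:ℝ) 1 ∧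
    T = {i | dist x (xs i) ≤ α ∧ β ≤ w i x}}

/-- The splitting number `T(W, S)` of a weight function. -/
def WeightFn.splitNum {E : Type*} [MetricSpace E] (W : WeightFn E) {n : ℕ}
    (xs : Fin n → E) : ℕ :=
  splitNumRaw xs (W.w n xs)

/-- Consistency with respect to accuracy: the accuracy of the learned classifier
converges in probability to the accuracy of the Bayes optimal classifier. -/
def ConsistentAcc {E : Type*} [MeasurableSpace E] (W : WeightFn E)
    (μ : Measure E) (η : E → ℝ) : Prop :=
  ∀ ε > (0:ℝ), ∀ δ > (0:ℝ), ∃ N : ℕ, ∀ n ≥ N,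
    ENNReal.ofReal (1 - δ) ≤
      sampleD μ η n {S | accuracy μ η (bayes η) - ε ≤ accuracy μ η (W.classify S)}

/-- Neighborhood consistency: for all `0 < ε, δ, κ < 1`, eventually with probability
at least `1 - δ` the astuteness w.r.t. `V^κ` is at least `A(g, D) - ε`. -/
def NbhdConsistent {E : Type*} [MetricSpace E] [MeasurableSpace E] (W : WeightFn E)
    (μ : Measure E) (η : E → ℝ) : Prop :=
  ∀ ε ∈ Ioo (0:ℝ) 1, ∀ δ ∈ Ioo (0:ℝ) 1, ∀ κ ∈ Ioo (0:ℝ) 1, ∃ N : ℕ, ∀ n ≥ N,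
    ENNReal.ofReal (1 - δ) ≤
      sampleD μ η n {S | accuracy μ η (bayes η) - ε ≤
        astuteness μ η (nbhdRegionK η κ) (W.classify S)}

/-- Condition 2 of the main theorem: vanishing expected supremal weight outside
the probability-radius balls. -/
def Cond2 {E : Type*} [MetricSpace E] [MeasurableSpace E] (W : WeightFn E)
    (μ : Measure E) (η : E → ℝ) : Prop :=
  ∀ p ∈ Ioo (0:ℝ) 1,
    Tendsto (fun n => ∫ S, (⨆ x : E, ∑ i, W.w n (fun j => (S j).1) i x *
      (if probRadius μ p x < dist x ((S i).1) then (1:ℝ) else 0)) ∂ sampleD μ η n)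
      atTop (nhds 0)

/-- Condition 3 of the main theorem: `E[t_n · sup_x max_i w_i(x)] → 0`. -/
def Cond3 {E : Type*} [MetricSpace E] [MeasurableSpace E] (W : WeightFn E)
    (μ : Measure E) (η : E → ℝ) (t : ℕ → ℕ) : Prop :=
  Tendsto (fun n => ∫ S, (t n : ℝ) *
    (⨆ x : E, ⨆ i, W.w n (fun j => (S j).1) i x) ∂ sampleD μ η n) atTop (nhds 0)

/-- Condition 4 of the main theorem: `E[log T(W,S) / t_n] → 0`. -/
def Cond4 {E : Type*} [MetricSpace E] [MeasurableSpace E] (W : WeightFn E)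
    (μ : Measure E) (η : E → ℝ) (t : ℕ → ℕ) : Prop :=
  Tendsto (fun n => ∫ S, Real.log (W.splitNum (fun j => (S j).1)) / (t n : ℝ)
    ∂ sampleD μ η n) atTop (nhds 0)

/-- `f` is a `k`-nearest neighbor classifier for the labelled sample `(xs, ys)`:
at every query point it takes a majority vote over some set of `k` nearest points. -/
def IsKNNClassifier {E : Type*} [MetricSpace E] {n : ℕ} (k : ℕ)
    (xs : Fin n → E) (ys : Fin n → Bool) (f : E → Bool) : Prop :=
  ∀ x : E, ∃ T : Finset (Fin n), T.card = min k n ∧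
    (∀ i ∈ T, ∀ j ∉ T, dist x (xs i) ≤ dist x (xs j)) ∧
    (f x = true ↔ 0 < ∑ i ∈ T, labelVal (ys i))

/-- `W` is the weight function of the `k_n`-nearest neighbor classifier. -/
def IsKNNWeightSeq {E : Type*} [MetricSpace E] (k : ℕ → ℕ) (W : WeightFn E) : Prop :=
  ∀ (n : ℕ) (xs : Fin n → E) (x : E), ∃ T : Finset (Fin n), T.card = min (k n) n ∧
    (∀ i ∈ T, ∀ j ∉ T, dist x (xs i) ≤ dist x (xs j)) ∧
    ∀ i, W.w n xs i x = if i ∈ T then ((min (k n) n : ℝ))⁻¹ else 0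

/-- `w` is the weight family of the `k`-nearest neighbor rule on the sample `xs`
with ties in distance broken by smaller value of `z`. -/
def IsKNNTieWeight {E : Type*} [MetricSpace E] {n : ℕ} (k : ℕ) (xs : Fin n → E)
    (z : Fin n → ℝ) (w : Fin n → E → ℝ) : Prop :=
  ∀ x : E, ∃ T : Finset (Fin n), T.card = min k n ∧
    (∀ i ∈ T, ∀ j ∉ T,
      dist x (xs i) < dist x (xs j) ∨ (dist x (xs i) = dist x (xs j) ∧ z i ≤ z j)) ∧
    ∀ i, w i x = if i ∈ T then ((min k n : ℝ))⁻¹ else 0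

/-- The kernel weights `w_i(x) = K(ρ(x,x_i)/h) / ∑_j K(ρ(x,x_j)/h)`. -/
def kernelW (K : ℝ → ℝ) (h : ℝ) {E : Type*} [MetricSpace E] {n : ℕ}
    (xs : Fin n → E) (i : Fin n) (x : E) : ℝ :=
  K (dist x (xs i) / h) / ∑ j, K (dist x (xs j) / h)

/-- The kernel classifier: `+1` iff `∑_i K(ρ(x,x_i)/h) y_i > 0`. -/
def kernelClassify (K : ℝ → ℝ) (h : ℝ) {E : Type*} [MetricSpace E] {n : ℕ}
    (S : Fin n → E × Bool) : E → Bool :=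
  fun x => if 0 < ∑ i, K (dist x ((S i).1) / h) * labelVal (S i).2 then true else false

end


section Blocks

/-- The finite set `T` of sample indices is the set of nearest neighbors of the query point `c`,
with all other sample points strictly farther away. -/
def StrictNearest {E ι : Type*} [MetricSpace E] (xs : ι → E) (T : Finset ι) (c : E) : Prop :=
  ∀ i ∈ T, ∀ j ∉ T, dist c (xs i) < dist c (xs j)

lemma StrictNearest.eq_of_card_eq {E ι : Type*} [MetricSpace E] {xs : ι → E} {T T' : Finset ι}
    {c : E} (hT : StrictNearest xs T c)
    (hT' : ∀ i ∈ T', ∀ j ∉ T', dist c (xs i) ≤ dist c (xs j)) (hcard : T'.card = T.card) :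
    T' = T := by
  by_contra hne
  obtain ⟨i, hi, hi'⟩ : ∃ i ∈ T, i ∉ T' := by
    by_contra! h
    exact hne (Finset.eq_of_subset_of_card_le h hcard.le).symm
  obtain ⟨j, hj, hj'⟩ : ∃ j ∈ T', j ∉ T := by
    by_contra! h
    exact hne (Finset.eq_of_subset_of_card_le h hcard.ge)
  exact absurd (hT i hi j hj') (not_lt.mpr (hT' j hj i hi'))

lemma isOpen_strictNearest {E ι : Type*} [MetricSpace E] [Finite ι] (T : Finset ι) :
    IsOpen {q : (ι → E) × E | StrictNearest q.1 T q.2} := by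
  have : {q : (ι → E) × E | StrictNearest q.1 T q.2} =
      ⋂ i ∈ T, ⋂ j ∈ (T : Set ι)ᶜ, {q | dist q.2 (q.1 i) < dist q.2 (q.1 j)} := by
    ext q; simp [StrictNearest]
  rw [this]
  refine isOpen_biInter_finset fun i _ => (Set.toFinite _).isOpen_biInter fun j _ => ?_
  exact isOpen_lt (by fun_prop) (by fun_prop)

/-- If at least `m * k` distinct real sample points lie in an order-connected set, then there are
`m` disjoint blocks of `k` points of that set, each of which is the set of the `k` nearest
neighbors of some query point of the set. -/
lemma exists_disjoint_strictNearest {ι : Type*} [Fintype ι] {xs : ι → ℝ}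
    (hxs : Function.Injective xs) {I : Set ℝ} (hI : I.OrdConnected) {k m : ℕ} (hk : 0 < k)
    (hm : m * k ≤ (Finset.univ.filter fun i => xs i ∈ I).card) :
    ∃ T : Fin m → Finset ι, Pairwise (fun l l' => Disjoint (T l) (T l')) ∧
      ∀ l, (T l).card = k ∧ (∀ i ∈ T l, xs i ∈ I) ∧ ∃ c ∈ I, StrictNearest xs (T l) c := by
  set J := Finset.univ.filter fun i => xs i ∈ I with hJ
  set A := J.image xs with hA
  have hAcard : A.card = J.card := Finset.card_image_of_injective _ hxs
  have hAI : ∀ y ∈ A, y ∈ I := by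
    intro y hy
    simp only [hA, hJ, Finset.mem_image, Finset.mem_filter] at hy
    obtain ⟨i, ⟨-, hi⟩, rfl⟩ := hy
    exact hi
  let e := A.orderEmbOfFin hAcard
  have he : ∀ i, e i ∈ I := fun i => hAI _ (A.orderEmbOfFin_mem hAcard i)
  have hidx : ∀ l : Fin m, l.1 * k + k ≤ J.card := fun l => by
    have : (l.1 + 1) * k ≤ m * k := Nat.mul_le_mul_right _ l.2
    linarith
  let a : Fin m → Fin J.card := fun l => ⟨l.1 * k, by have := hidx l; omega⟩
  let b : Fin m → Fin J.card := fun l => ⟨l.1 * k + k - 1, by have := hidx l; omega⟩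
  have hab : ∀ l, a l ≤ b l := fun l => by simp only [a, b, Fin.mk_le_mk]; omega
  have hba : ∀ l l' : Fin m, l < l' → b l < a l' := fun l l' h => by
    have : (l.1 + 1) * k ≤ l'.1 * k := Nat.mul_le_mul_right _ h
    simp only [a, b, Fin.mk_lt_mk]
    rw [add_mul] at this
    omega
  have hdisj : ∀ l l' : Fin m, l < l' →
      Disjoint (Finset.univ.filter fun i => xs i ∈ Icc (e (a l)) (e (b l)))
        (Finset.univ.filter fun i => xs i ∈ Icc (e (a l')) (e (b l'))) := by
    intro l l' h
    rw [Finset.disjoint_left]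
    intro i hi hi'
    simp only [Finset.mem_filter, Finset.mem_univ, true_and, Set.mem_Icc] at hi hi'
    have := e.strictMono (hba l l' h)
    linarith [hi.2, hi'.1]
  refine ⟨fun l => Finset.univ.filter fun i => xs i ∈ Icc (e (a l)) (e (b l)), ?_, fun l =>
    ⟨?_, ?_, (e (a l) + e (b l)) / 2, ?_, ?_⟩⟩
  · intro l l' h
    rcases lt_or_gt_of_ne h with h | h
    · exact hdisj l l' h
    · exact (hdisj l' l h).symm
  · have : (Finset.univ.filter fun i => xs i ∈ Icc (e (a l)) (e (b l))).image xs =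
        (Finset.Icc (a l) (b l)).image e := by
      ext y
      simp only [Finset.mem_image, Finset.mem_filter, Finset.mem_univ, true_and,
        Finset.mem_Icc, Set.mem_Icc]
      constructor
      · rintro ⟨i, hi, rfl⟩
        have hiA : xs i ∈ A := by
          simp only [hA, hJ, Finset.mem_image, Finset.mem_filter, Finset.mem_univ, true_and]
          exact ⟨i, hI.out (he _) (he _) hi, rfl⟩
        rw [← Finset.mem_coe, ← A.range_orderEmbOfFin hAcard] at hiA
        obtain ⟨t, ht⟩ := hiA
        refine ⟨t, ?_, ht⟩
        rw [← ht] at hi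
        exact ⟨e.le_iff_le.mp hi.1, e.le_iff_le.mp hi.2⟩
      · rintro ⟨t, ht, rfl⟩
        have := A.orderEmbOfFin_mem hAcard t
        simp only [hA, Finset.mem_image] at this
        obtain ⟨i, -, hi⟩ := this
        refine ⟨i, ?_, hi⟩
        rw [hi]
        exact ⟨e.monotone ht.1, e.monotone ht.2⟩
    rw [← Finset.card_image_of_injective _ hxs, this, Finset.card_image_of_injective _ e.injective,
      Fin.card_Icc]
    simp only [a, b]
    omega
  · intro i hi
    simp only [Finset.mem_filter, Finset.mem_univ, true_and] at hi
    exact hI.out (he _) (he _) hi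
  · have := e.monotone (hab l)
    exact hI.out (he (a l)) (he (b l)) ⟨by linarith, by linarith⟩
  · intro i hi j hj
    simp only [Finset.mem_filter, Finset.mem_univ, true_and, Set.mem_Icc, not_and_or,
      not_le] at hi hj
    have := e.monotone (hab l)
    rw [Real.dist_eq, Real.dist_eq]
    have hle : |(e (a l) + e (b l)) / 2 - xs i| ≤ (e (b l) - e (a l)) / 2 :=
      abs_le.mpr ⟨by linarith, by linarith⟩
    refine hle.trans_lt ?_
    rw [lt_abs]
    rcases hj with hj | hj
    · left; linarith
    · right; linarith

end Blocks

section Votes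

open ProbabilityTheory

/-- The uniform distribution on `[-1/2, 1/2]`. -/
noncomputable def symUnif : Measure ℝ := volume.restrict (Icc (-(1 / 2) : ℝ) (1 / 2))

/-- The uniform distribution on `[0, 1]`. -/
noncomputable def unitUnif : Measure ℝ := volume.restrict (Icc (0 : ℝ) 1)

instance : IsProbabilityMeasure symUnif := ⟨by simp [symUnif]; norm_num⟩

instance : IsProbabilityMeasure unitUnif := ⟨by simp [unitUnif]⟩

lemma measurePreserving_neg_symUnif : MeasurePreserving (fun v : ℝ => -v) symUnif symUnif := by
  have h := (Measure.measurePreserving_neg (volume : Measure ℝ)).restrict_preimage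
    (s := Icc (-(1 / 2) : ℝ) (1 / 2)) measurableSet_Icc
  have hs : (Neg.neg : ℝ → ℝ) ⁻¹' Icc (-(1 / 2) : ℝ) (1 / 2) = Icc (-(1 / 2) : ℝ) (1 / 2) := by
    ext v; simp only [mem_preimage, mem_Icc]; constructor <;> intro h <;> constructor <;> linarith
  rw [hs] at h
  exact h

lemma symUnif_abs_gt {Δ : ℝ} (h0 : 0 ≤ Δ) (h1 : Δ ≤ 1 / 2) :
    symUnif {v | Δ < |v|} = ENNReal.ofReal (1 - 2 * Δ) := by
  have hc : {v : ℝ | Δ < |v|}ᶜ = Icc (-Δ) Δ := by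
    ext v; simp [abs_le]
  have hm : MeasurableSet {v : ℝ | Δ < |v|} := measurableSet_lt measurable_const measurable_abs
  rw [← compl_compl {v : ℝ | Δ < |v|}, prob_compl_eq_one_sub hm.compl, hc, symUnif,
    Measure.restrict_apply measurableSet_Icc,
    inter_eq_left.mpr (Icc_subset_Icc (by linarith) (by linarith)), Real.volume_Icc,
    ← ENNReal.ofReal_one, ← ENNReal.ofReal_sub _ (by linarith)]
  congr 1; ring

lemma symUnif_lt {t : ℝ} (h1 : t ≤ 1 / 2) :
    symUnif {v | v < t} = ENNReal.ofReal (t + 1 / 2) := by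
  rw [symUnif, Measure.restrict_apply (show MeasurableSet {v : ℝ | v < t} from measurableSet_Iio)]
  have : {v : ℝ | v < t} ∩ Icc (-(1 / 2)) (1 / 2) = Ico (-(1 / 2)) t := by
    ext v; simp only [mem_inter_iff, mem_ofPred_eq, mem_Icc, mem_Ico]
    constructor
    · rintro ⟨h, h', -⟩; exact ⟨h', h⟩
    · rintro ⟨h, h'⟩; exact ⟨h', h, by linarith⟩
  rw [this, Real.volume_Ico]
  congr 1; ring

/-- All coordinates in `T` have absolute value larger than `Δ` and at least half of them are
positive. -/
def votesNeg {ι : Type*} (Δ : ℝ) (T : Finset ι) : Set (ι → ℝ) :=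
  {v | (∀ i ∈ T, Δ < |v i|) ∧ ∑ i ∈ T, labelVal (decide (v i < 0)) ≤ 0}

lemma measurable_labelVal_decide_neg : Measurable fun v : ℝ => labelVal (decide (v < 0)) := by
  have : (fun v : ℝ => labelVal (decide (v < 0))) = fun v => if v < 0 then (1 : ℝ) else -1 := by
    ext v; simp [labelVal]
  rw [this]
  exact Measurable.ite measurableSet_Iio measurable_const measurable_const

lemma measurableSet_votesNeg_iSup {ι : Type*} (Δ : ℝ) (T : Finset ι) :
    MeasurableSet[⨆ i ∈ (T : Set ι), (inferInstance : MeasurableSpace ℝ).comap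
      (fun v : ι → ℝ => v i)] (votesNeg Δ T) := by
  set m : MeasurableSpace (ι → ℝ) := ⨆ i ∈ (T : Set ι),
    (inferInstance : MeasurableSpace ℝ).comap (fun v : ι → ℝ => v i) with hm
  have hmeas : ∀ i ∈ T, Measurable[m] fun v : ι → ℝ => v i := fun i hi =>
    Measurable.mono (comap_measurable _)
      (le_iSup₂_of_le (f := fun i (_ : i ∈ (T : Set ι)) =>
        (inferInstance : MeasurableSpace ℝ).comap (fun v : ι → ℝ => v i)) i hi le_rfl) le_rfl
  have hset : votesNeg Δ T = (⋂ i ∈ T, {v | Δ < |v i|}) ∩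
      {v | ∑ i ∈ T, labelVal (decide (v i < 0)) ≤ 0} := by
    ext v; simp [votesNeg]
  rw [hset]
  refine MeasurableSet.inter (Finset.measurableSet_biInter _ fun i hi => ?_) ?_
  · exact measurableSet_lt measurable_const (measurable_abs.comp (hmeas i hi))
  · refine measurableSet_le (Finset.measurable_fun_sum _ fun i hi => ?_) measurable_const
    exact measurable_labelVal_decide_neg.comp (hmeas i hi)

lemma iSup_comap_eval_le {ι : Type*} (S : Set ι) :
    (⨆ i ∈ S, (inferInstance : MeasurableSpace ℝ).comap (fun v : ι → ℝ => v i)) ≤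
      MeasurableSpace.pi :=
  iSup₂_le fun i _ => (measurable_pi_apply i).comap_le

lemma measurableSet_votesNeg {ι : Type*} (Δ : ℝ) (T : Finset ι) :
    MeasurableSet (votesNeg Δ T) :=
  iSup_comap_eval_le _ _ (measurableSet_votesNeg_iSup Δ T)

lemma iIndep_comap_eval {ι : Type*} [Fintype ι] (ν : Measure ℝ) [IsProbabilityMeasure ν] :
    iIndep (fun i => (inferInstance : MeasurableSpace ℝ).comap (fun v : ι → ℝ => v i))
      (Measure.pi fun _ : ι => ν) :=
  (iIndepFun_iff_iIndep ..).mp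
    (iIndepFun_pi (μ := fun _ : ι => ν) (X := fun _ v => v) fun _ => aemeasurable_id)

/-- Events depending on pairwise disjoint sets of coordinates are independent under a product
measure. -/
lemma pi_biInter_eq_prod {ι κ : Type*} [Fintype ι] (ν : Measure ℝ)
    [IsProbabilityMeasure ν] (T : κ → Finset ι) (hT : Pairwise fun l l' => Disjoint (T l) (T l'))
    (B : κ → Set (ι → ℝ))
    (hB : ∀ l, MeasurableSet[⨆ i ∈ (T l : Set ι), (inferInstance : MeasurableSpace ℝ).comap
      (fun v : ι → ℝ => v i)] (B l)) (s : Finset κ) :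
    (Measure.pi fun _ : ι => ν) (⋂ l ∈ s, B l) = ∏ l ∈ s, (Measure.pi fun _ : ι => ν) (B l) := by
  induction s using Finset.cons_induction with
  | empty => simp
  | cons a s ha ih =>
    have hind := indep_iSup_of_disjoint (S := (T a : Set ι))
      (T := ⋃ l ∈ s, (T l : Set ι)) (fun i => (measurable_pi_apply i).comap_le)
      (iIndep_comap_eval (ι := ι) ν) (by
        rw [Set.disjoint_iUnion₂_right]
        intro l hl
        exact_mod_cast hT (ne_of_mem_of_not_mem hl ha).symm)
    have hsplit : ⋂ l ∈ Finset.cons a s ha, B l = B a ∩ ⋂ l ∈ s, B l := by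
      ext v; simp
    rw [Finset.prod_cons, hsplit, ← ih]
    refine (Indep_iff _ _ _).mp hind _ _ (hB a) ?_
    refine Finset.measurableSet_biInter _ fun l hl => ?_
    refine (iSup_le_iSup_of_subset ?_ :
      (⨆ i ∈ (T l : Set ι), (inferInstance : MeasurableSpace ℝ).comap
      (fun v : ι → ℝ => v i)) ≤ _) _ (hB l)
    exact Set.subset_biUnion_of_mem (u := fun l => (T l : Set ι)) hl

lemma half_pow_le_pi_votesNeg {ι : Type*} [Fintype ι] {Δ : ℝ} (h0 : 0 ≤ Δ) (h1 : Δ ≤ 1 / 2)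
    (T : Finset ι) :
    ENNReal.ofReal ((1 - 2 * Δ) ^ T.card / 2) ≤
      (Measure.pi fun _ : ι => symUnif) (votesNeg Δ T) := by
  set P := Measure.pi fun _ : ι => symUnif
  have hneg : MeasurePreserving (fun (v : ι → ℝ) i => -v i) P P :=
    measurePreserving_pi _ _ fun _ => measurePreserving_neg_symUnif
  have hH : P {v | ∀ i ∈ T, Δ < |v i|} = ENNReal.ofReal ((1 - 2 * Δ) ^ T.card) := by
    have : {v : ι → ℝ | ∀ i ∈ T, Δ < |v i|} =
        Set.univ.pi fun i => if i ∈ T then {v : ℝ | Δ < |v|} else Set.univ := by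
      ext v
      simp only [mem_ofPred_eq, Set.mem_pi, mem_univ, true_implies]
      refine forall_congr' fun i => ?_
      by_cases hi : i ∈ T <;> simp [hi]
    rw [this, Measure.pi_pi]
    have : ∀ i, symUnif (if i ∈ T then {v : ℝ | Δ < |v|} else Set.univ) =
        if i ∈ T then ENNReal.ofReal (1 - 2 * Δ) else 1 := by
      intro i; split_ifs
      · exact symUnif_abs_gt h0 h1
      · exact measure_univ
    simp_rw [this]
    rw [Finset.prod_ite_mem, Finset.univ_inter, Finset.prod_const,
      ENNReal.ofReal_pow (by linarith)]
  have hcover : {v : ι → ℝ | ∀ i ∈ T, Δ < |v i|} ⊆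
      votesNeg Δ T ∪ (fun (v : ι → ℝ) i => -v i) ⁻¹' votesNeg Δ T := by
    intro v hv
    have hflip : ∑ i ∈ T, labelVal (decide (-v i < 0)) =
        -∑ i ∈ T, labelVal (decide (v i < 0)) := by
      rw [← Finset.sum_neg_distrib]
      refine Finset.sum_congr rfl fun i hi => ?_
      have hne : v i ≠ 0 := abs_pos.mp (h0.trans_lt (hv i hi))
      rcases lt_or_gt_of_ne hne with h | h
      · simp [labelVal, h, h.le]
      · simp [labelVal, h, h.not_gt]
    rcases le_total (∑ i ∈ T, labelVal (decide (v i < 0))) 0 with h | h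
    · exact Or.inl ⟨hv, h⟩
    · refine Or.inr ⟨fun i hi => by simpa using hv i hi, ?_⟩
      simp only
      rw [hflip]
      linarith
  have h2 : ENNReal.ofReal ((1 - 2 * Δ) ^ T.card) ≤ 2 * P (votesNeg Δ T) := by
    rw [← hH, two_mul]
    refine (measure_mono hcover).trans ((measure_union_le _ _).trans_eq ?_)
    rw [hneg.measure_preimage (measurableSet_votesNeg Δ T).nullMeasurableSet]
  rw [ENNReal.ofReal_div_of_pos two_pos]
  refine ENNReal.div_le_of_le_mul ?_
  rw [mul_comm _ (ENNReal.ofReal 2), ENNReal.ofReal_ofNat]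
  exact h2

end Votes

section Sample

open ProbabilityTheory

/-- No block of `k` nearest neighbors inside `I` has all its vote variables larger than `Δ` in
absolute value with a nonpositive vote. -/
def noNegBlock {ι : Type*} (k : ℕ) (Δ : ℝ) (I : Set ℝ) : Set ((ι → ℝ) × (ι → ℝ)) :=
  {z | ∀ T : Finset ι, T.card = k → (∀ i ∈ T, z.1 i ∈ I) → (∃ c ∈ I, StrictNearest z.1 T c) →
    z.2 ∉ votesNeg Δ T}

lemma measurableSet_noNegBlock {ι : Type*} [Fintype ι] (k : ℕ) (Δ : ℝ) {I : Set ℝ}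
    (hI : IsOpen I) : MeasurableSet (noNegBlock (ι := ι) k Δ I) := by
  have hset : (noNegBlock (ι := ι) k Δ I)ᶜ = ⋃ T : Finset ι, ⋃ _ : T.card = k,
      ((⋂ i ∈ T, {xs : ι → ℝ | xs i ∈ I}) ∩ ⋃ c ∈ I, {xs | StrictNearest xs T c}) ×ˢ
        votesNeg Δ T := by
    ext z
    simp only [noNegBlock, mem_compl_iff, mem_ofPred_eq, not_forall, not_not, mem_iUnion,
      mem_prod, mem_inter_iff, mem_iInter, exists_prop, and_assoc]
  refine MeasurableSet.of_compl ?_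
  rw [hset]
  refine MeasurableSet.iUnion fun T => MeasurableSet.iUnion fun _ =>
    MeasurableSet.prod (MeasurableSet.inter ?_ ?_) (measurableSet_votesNeg Δ T)
  · exact Finset.measurableSet_biInter _ fun i _ => hI.measurableSet.preimage (measurable_pi_apply i)
  · refine (isOpen_biUnion fun c _ => ?_).measurableSet
    exact (isOpen_strictNearest T).preimage (f := fun xs : ι → ℝ => (xs, c)) (by fun_prop)

lemma pi_symUnif_noNegBlock_le {ι : Type*} [Fintype ι] {k : ℕ} (hk : 0 < k) {Δ : ℝ}
    (h0 : 0 ≤ Δ) (h1 : Δ ≤ 1 / 2) {I : Set ℝ} (hI : I.OrdConnected) {xs : ι → ℝ}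
    (hxs : Function.Injective xs) :
    (Measure.pi fun _ : ι => symUnif) (Prod.mk xs ⁻¹' noNegBlock k Δ I) ≤
      ENNReal.ofReal
        (2 * (1 - (1 - 2 * Δ) ^ k / 2 / k) ^ (Finset.univ.filter fun i => xs i ∈ I).card) := by
  set P := Measure.pi fun _ : ι => symUnif
  set N := (Finset.univ.filter fun i => xs i ∈ I).card
  set p : ℝ := (1 - 2 * Δ) ^ k / 2 with hp
  have hp0 : 0 ≤ p := by have : 0 ≤ 1 - 2 * Δ := by linarith
                         positivity
  have hp1 : p ≤ 1 / 2 := by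
    have : (1 - 2 * Δ) ^ k ≤ 1 := pow_le_one₀ (by linarith) (by linarith)
    linarith
  have hk1 : (1 : ℝ) ≤ k := by exact_mod_cast hk
  have hpk : p / k ≤ 1 / 2 := (div_le_self hp0 hk1).trans hp1
  have hpk0 : 0 ≤ p / k := by positivity
  obtain ⟨T, hT, hTprop⟩ :=
    exists_disjoint_strictNearest hxs hI hk (m := N / k) (Nat.div_mul_le_self _ _)
  have hsub : Prod.mk xs ⁻¹' noNegBlock k Δ I ⊆ ⋂ l ∈ Finset.univ, (votesNeg Δ (T l))ᶜ := by
    intro v hv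
    simp only [Finset.mem_univ, iInter_true, mem_iInter, mem_compl_iff]
    exact fun l => hv (T l) (hTprop l).1 (hTprop l).2.1 (hTprop l).2.2
  have hr : (1 - p) ≤ (1 - p / k) ^ k := by
    have := one_add_mul_le_pow (a := -(p / k)) (by linarith) k
    have hc : (k : ℝ) * -(p / k) = -p := by field_simp
    rw [hc] at this
    simpa [sub_eq_add_neg] using this
  have hreal : (1 - p) ^ (N / k) ≤ 2 * (1 - p / k) ^ N := by
    calc (1 - p) ^ (N / k) ≤ ((1 - p / k) ^ k) ^ (N / k) :=
          pow_le_pow_left₀ (by linarith) hr _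
      _ ≤ 2 * ((1 - p / k) ^ k * ((1 - p / k) ^ k) ^ (N / k)) := by
          have : 0 ≤ ((1 - p / k) ^ k) ^ (N / k) := by
            have : 0 ≤ 1 - p / k := by linarith
            positivity
          nlinarith
      _ = 2 * (1 - p / k) ^ (k + k * (N / k)) := by rw [pow_add, pow_mul]
      _ ≤ 2 * (1 - p / k) ^ N := by
          refine mul_le_mul_of_nonneg_left
            (pow_le_pow_of_le_one (by linarith) (by linarith) ?_) two_pos.le
          have := Nat.div_add_mod N k
          have := Nat.mod_lt N hk
          omega
  calc P (Prod.mk xs ⁻¹' noNegBlock k Δ I)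
      ≤ P (⋂ l ∈ Finset.univ, (votesNeg Δ (T l))ᶜ) := measure_mono hsub
    _ = ∏ l : Fin (N / k), P (votesNeg Δ (T l))ᶜ :=
        pi_biInter_eq_prod symUnif T hT _
          (fun l => (measurableSet_votesNeg_iSup Δ (T l)).compl) _
    _ ≤ ∏ _l : Fin (N / k), ENNReal.ofReal (1 - p) := by
        refine Finset.prod_le_prod' fun l _ => ?_
        rw [prob_compl_eq_one_sub (measurableSet_votesNeg Δ (T l)),
          ENNReal.ofReal_sub _ hp0, ENNReal.ofReal_one]
        refine tsub_le_tsub_left ?_ _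
        have := half_pow_le_pi_votesNeg h0 h1 (T l)
        rwa [(hTprop l).1] at this
    _ = ENNReal.ofReal ((1 - p) ^ (N / k)) := by
        rw [Finset.prod_const, Finset.card_univ, Fintype.card_fin,
          ENNReal.ofReal_pow (by linarith)]
    _ ≤ _ := ENNReal.ofReal_le_ofReal hreal

lemma ae_injective_pi_unitUnif {ι : Type*} [Fintype ι] :
    ∀ᵐ xs : ι → ℝ ∂(Measure.pi fun _ : ι => unitUnif), Function.Injective xs := by
  have hac : (Measure.pi fun _ : ι => unitUnif) ≪ (volume : Measure (ι → ℝ)) := by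
    simp only [unitUnif]
    rw [← Measure.restrict_pi_pi]
    exact Measure.absolutelyContinuous_of_le Measure.restrict_le_self
  refine hac.ae_le ?_
  have hne : ∀ i j : ι, i ≠ j → ∀ᵐ xs : ι → ℝ, xs i ≠ xs j := by
    intro i j hij
    let L : (ι → ℝ) →ₗ[ℝ] ℝ := 
      LinearMap.proj (R := ℝ) (φ := fun _ : ι => ℝ) i - LinearMap.proj (R := ℝ) (φ := fun _ : ι => ℝ) j
    have hL : LinearMap.ker L ≠ ⊤ := by
      intro h
      have : L (Pi.single i 1) = 0 := by
        rw [← LinearMap.mem_ker, h]; trivial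
      simp [L, hij.symm] at this
    have h0 := Measure.addHaar_submodule (volume : Measure (ι → ℝ)) _ hL
    rw [ae_iff]
    convert h0 using 2
    ext xs
    simp [L, sub_eq_zero]
  have hall : ∀ᵐ xs : ι → ℝ, ∀ i j : ι, i ≠ j → xs i ≠ xs j :=
    ae_all_iff.mpr fun i => ae_all_iff.mpr fun j => by
      by_cases h : i = j
      · simp [h]
      · simpa [h] using hne i j h
  filter_upwards [hall] with xs h i j hij
  by_contra hne
  exact h i j hne hij

lemma lintegral_pow_card_filter {ι : Type*} [Fintype ι] {I : Set ℝ} (hI : MeasurableSet I)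
    (μ : Measure ℝ) [IsProbabilityMeasure μ] (r : ℝ≥0∞) :
    ∫⁻ xs : ι → ℝ, r ^ (Finset.univ.filter fun i => xs i ∈ I).card ∂(Measure.pi fun _ => μ) =
      (r * μ I + μ Iᶜ) ^ Fintype.card ι := by
  let g : ℝ → ℝ≥0∞ := fun x => if x ∈ I then r else 1
  have hg : Measurable g := Measurable.ite hI measurable_const measurable_const
  have h := lintegral_prod_eq_prod_lintegral_of_indepFun (Finset.univ : Finset ι)
    (fun i (v : ι → ℝ) => g (v i))
    (iIndepFun_pi (μ := fun _ : ι => μ) (X := fun _ => g) fun _ => hg.aemeasurable)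
    (fun i => hg.comp (measurable_pi_apply i))
  have hlhs : ∀ xs : ι → ℝ, r ^ (Finset.univ.filter fun i => xs i ∈ I).card = ∏ i, g (xs i) := by
    intro xs
    simp [g, Finset.prod_ite]
  simp_rw [hlhs]
  rw [h]
  have hone : ∀ i : ι, ∫⁻ v : ι → ℝ, g (v i) ∂(Measure.pi fun _ => μ) = r * μ I + μ Iᶜ := by
    intro i
    rw [(measurePreserving_eval (fun _ : ι => μ) i).lintegral_comp hg]
    have : g = fun x => I.indicator (fun _ => r) x + Iᶜ.indicator (fun _ => 1) x := by
      ext x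
      by_cases hx : x ∈ I <;> simp [g, hx]
    rw [this, lintegral_add_left (measurable_const.indicator hI), lintegral_indicator_const hI,
      lintegral_indicator_const hI.compl, one_mul]
  simp_rw [hone]
  simp

lemma prod_noNegBlock_le {ι : Type*} [Fintype ι] {k : ℕ} (hk : 0 < k) {Δ : ℝ}
    (h0 : 0 ≤ Δ) (h1 : Δ ≤ 1 / 2) {I : Set ℝ} (hI : I.OrdConnected) (hIo : IsOpen I) :
    ((Measure.pi fun _ : ι => unitUnif).prod (Measure.pi fun _ : ι => symUnif))
        (noNegBlock k Δ I) ≤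
      ENNReal.ofReal
        (2 * (1 - (1 - 2 * Δ) ^ k / 2 / k * unitUnif.real I) ^ Fintype.card ι) := by
  have hd0 : 0 ≤ 1 - 2 * Δ := by linarith
  set t : ℝ := (1 - 2 * Δ) ^ k / 2 / k with ht
  have ht0 : 0 ≤ t := by positivity
  have ht1 : t ≤ 1 := by
    have h : (1 - 2 * Δ) ^ k ≤ 1 := pow_le_one₀ hd0 (by linarith)
    have hk1 : (1 : ℝ) ≤ k := by exact_mod_cast hk
    rw [ht]
    exact (div_le_self (by positivity) hk1).trans (by linarith)
  have hle : ∀ᵐ xs ∂(Measure.pi fun _ : ι => unitUnif),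
      (Measure.pi fun _ : ι => symUnif) (Prod.mk xs ⁻¹' noNegBlock k Δ I) ≤
        2 * ENNReal.ofReal (1 - t) ^ (Finset.univ.filter fun i => xs i ∈ I).card := by
    filter_upwards [ae_injective_pi_unitUnif] with xs hxs
    refine (pi_symUnif_noNegBlock_le hk h0 h1 hI hxs).trans_eq ?_
    rw [ENNReal.ofReal_mul two_pos.le, ENNReal.ofReal_pow (by linarith), ENNReal.ofReal_ofNat]
  rw [Measure.prod_apply (measurableSet_noNegBlock k Δ hIo)]
  refine (lintegral_mono_ae hle).trans_eq ?_
  rw [lintegral_const_mul' _ _ (by simp), lintegral_pow_card_filter hIo.measurableSet,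
    ENNReal.ofReal_mul two_pos.le, ENNReal.ofReal_ofNat, ← ofReal_measureReal (s := I),
    ← ofReal_measureReal (s := Iᶜ), ← ENNReal.ofReal_mul (by linarith),
    ← ENNReal.ofReal_add (mul_nonneg (by linarith) measureReal_nonneg) measureReal_nonneg,
    probReal_compl_eq_one_sub hIo.measurableSet, ENNReal.ofReal_pow]
  · congr 3; ring
  · nlinarith [measureReal_le_one (μ := unitUnif) (s := I),
      measureReal_nonneg (μ := unitUnif) (s := I)]

end Sample

section JointDistribution

open ProbabilityTheory

lemma jointD_apply {E : Type*} [MeasurableSpace E] (μ : Measure E) {η : E → ℝ}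
    (hη : Measurable η) {s : Set (E × Bool)} (hs : MeasurableSet s) :
    jointD μ η s = ∫⁻ x, ENNReal.ofReal (η x) * s.indicator 1 (x, true) +
      ENNReal.ofReal (1 - η x) * s.indicator 1 (x, false) ∂μ := by
  have hκ : Measurable fun x : E =>
      ENNReal.ofReal (η x) • Measure.dirac (x, true) +
        ENNReal.ofReal (1 - η x) • Measure.dirac (x, false) := by
    refine Measure.measurable_of_measurable_coe _ fun t ht => ?_
    simp only [Measure.coe_add, Measure.coe_smul, Pi.add_apply, Pi.smul_apply, smul_eq_mul,
      Measure.dirac_apply' _ ht]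
    have hi : Measurable (t.indicator (1 : E × Bool → ℝ≥0∞)) := measurable_one.indicator ht
    have h1 : Measurable fun x : E => t.indicator (1 : E × Bool → ℝ≥0∞) (x, true) :=
      hi.comp (by fun_prop)
    have h2 : Measurable fun x : E => t.indicator (1 : E × Bool → ℝ≥0∞) (x, false) :=
      hi.comp (by fun_prop)
    exact (hη.ennreal_ofReal.mul h1).add ((measurable_const.sub hη).ennreal_ofReal.mul h2)
  rw [jointD, Measure.bind_apply hs hκ.aemeasurable]
  simp only [Measure.coe_add, Measure.coe_smul, Pi.add_apply, Pi.smul_apply, smul_eq_mul,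
    Measure.dirac_apply' _ hs]

lemma ae_unitUnif_mem_Icc : ∀ᵐ x ∂unitUnif, x ∈ Icc (0 : ℝ) 1 :=
  ae_restrict_mem measurableSet_Icc

/-- An instance together with its label, generated from an instance and a vote variable. -/
noncomputable def labelOf (z : ℝ × ℝ) : ℝ × Bool := (z.1, decide (z.2 < z.1 - 1 / 2))

lemma measurable_labelOf : Measurable labelOf := by
  refine measurable_fst.prodMk (measurable_to_bool ?_)
  have : (fun z : ℝ × ℝ => decide (z.2 < z.1 - 1 / 2)) ⁻¹' {true} = {z | z.2 < z.1 - 1 / 2} := by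
    ext z; exact decide_eq_true_iff
  rw [this]
  exact measurableSet_lt measurable_snd (measurable_fst.sub_const _)

lemma jointD_unitUnif_eq_map :
    jointD unitUnif (fun x => x) = (unitUnif.prod symUnif).map labelOf := by
  ext s hs
  rw [jointD_apply _ measurable_id' hs, Measure.map_apply measurable_labelOf hs,
    Measure.prod_apply (measurable_labelOf hs)]
  refine lintegral_congr_ae ?_
  filter_upwards [ae_unitUnif_mem_Icc] with x hx
  have hlt : MeasurableSet {v : ℝ | v < x - 1 / 2} := measurableSet_Iio
  have h1 : symUnif {v | v < x - 1 / 2} = ENNReal.ofReal x := by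
    rw [symUnif_lt (by linarith [hx.2])]; congr 1; ring
  have h2 : symUnif {v | v < x - 1 / 2}ᶜ = ENNReal.ofReal (1 - x) := by
    rw [prob_compl_eq_one_sub hlt, h1, ENNReal.ofReal_sub _ hx.1, ENNReal.ofReal_one]
  rw [← measure_inter_add_sdiff (Prod.mk x ⁻¹' (labelOf ⁻¹' s)) hlt, ← h1, ← h2]
  congr 1
  · by_cases h : (x, true) ∈ s
    · rw [indicator_of_mem h, Pi.one_apply, mul_one]
      congr 1
      ext v
      simp only [mem_ofPred_eq, mem_inter_iff, mem_preimage, labelOf]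
      exact ⟨fun hv => ⟨by rwa [decide_eq_true hv], hv⟩, fun hv => hv.2⟩
    · rw [indicator_of_notMem h, mul_zero, eq_comm]
      convert measure_empty (μ := symUnif)
      ext v
      simp only [mem_ofPred_eq, mem_inter_iff, mem_preimage, labelOf, mem_empty_iff_false,
        iff_false, not_and]
      intro hv hv'
      exact h (by rwa [decide_eq_true hv'] at hv)
  · by_cases h : (x, false) ∈ s
    · rw [indicator_of_mem h, Pi.one_apply, mul_one]
      congr 1
      ext v
      simp only [mem_ofPred_eq, Set.mem_sdiff, mem_compl_iff, mem_preimage, labelOf]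
      exact ⟨fun hv => ⟨by rwa [decide_eq_false hv], hv⟩, fun hv => hv.2⟩
    · rw [indicator_of_notMem h, mul_zero, eq_comm]
      convert measure_empty (μ := symUnif)
      ext v
      simp only [mem_ofPred_eq, Set.mem_sdiff, mem_preimage, labelOf, mem_empty_iff_false,
        iff_false, not_and, not_not]
      intro hv
      by_contra hv'
      exact h (by rwa [decide_eq_false hv'] at hv)

instance : IsProbabilityMeasure (jointD unitUnif fun x => x) := by
  rw [jointD_unitUnif_eq_map]
  exact Measure.isProbabilityMeasure_map measurable_labelOf.aemeasurable

/-- The labelled sample generated from instances and vote variables. -/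
noncomputable def sampleOf {n : ℕ} (z : (Fin n → ℝ) × (Fin n → ℝ)) : Fin n → ℝ × Bool :=
  fun i => labelOf (z.1 i, z.2 i)

lemma measurable_sampleOf {n : ℕ} : Measurable (sampleOf (n := n)) :=
  measurable_pi_iff.mpr fun i => measurable_labelOf.comp
    (((measurable_pi_apply i).comp measurable_fst).prodMk
      ((measurable_pi_apply i).comp measurable_snd))

lemma sampleD_unitUnif_eq_map (n : ℕ) :
    sampleD unitUnif (fun x => x) n =
      ((Measure.pi fun _ : Fin n => unitUnif).prod
        (Measure.pi fun _ : Fin n => symUnif)).map sampleOf := by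
  have h := measurePreserving_arrowProdEquivProdArrow ℝ ℝ (Fin n)
    (fun _ => unitUnif) (fun _ => symUnif)
  rw [sampleD, jointD_unitUnif_eq_map, ← h.map_eq,
    Measure.map_map measurable_sampleOf h.measurable]
  have := Measure.isProbabilityMeasure_map (μ := unitUnif.prod symUnif)
    measurable_labelOf.aemeasurable
  rw [← Measure.pi_map_pi (fun _ => measurable_labelOf.aemeasurable)]
  rfl

end JointDistribution

section Astuteness

/-- Off a countable set, the region where a nearest neighbor classifier with distinct real
instances answers `true` is measurable. -/
lemma IsKNNClassifier.exists_measurableSet {n k : ℕ} {xs : Fin n → ℝ}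
    (hxs : Function.Injective xs) {ys : Fin n → Bool} {f : ℝ → Bool}
    (hf : IsKNNClassifier k xs ys f) :
    ∃ F P : Set ℝ, F.Countable ∧ MeasurableSet P ∧ ∀ x ∉ F, (f x = true ↔ x ∈ P) := by
  refine ⟨Set.range fun q : Fin n × Fin n => (xs q.1 + xs q.2) / 2,
    ⋃ T : Finset (Fin n), ⋃ _ : T.card = min k n ∧ 0 < ∑ i ∈ T, labelVal (ys i),
      {x | StrictNearest xs T x}, Set.countable_range _, ?_, fun x hx => ?_⟩
  · refine MeasurableSet.iUnion fun T => MeasurableSet.iUnion fun _ => IsOpen.measurableSet ?_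
    exact (isOpen_strictNearest T).preimage (f := fun x : ℝ => (xs, x)) (by fun_prop)
  · obtain ⟨T, hcard, hnear, hvote⟩ := hf x
    simp only [mem_iUnion, exists_prop, mem_ofPred_eq]
    rw [hvote]
    constructor
    · refine fun h => ⟨T, ⟨hcard, h⟩, fun i hi j hj => (hnear i hi j hj).lt_of_ne fun heq => ?_⟩
      have hij : xs i ≠ xs j := fun h => hj (hxs h ▸ hi)
      rw [Real.dist_eq, Real.dist_eq, abs_eq_abs] at heq
      rcases heq with heq | heq
      · exact hij (by linarith)
      · exact hx ⟨(i, j), by simp only; linarith⟩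
    · rintro ⟨T', ⟨hcard', hvote'⟩, hstrict⟩
      rwa [hstrict.eq_of_card_eq hnear (hcard.trans hcard'.symm)]

lemma self_mem_nbhdRegionK_id {κ x : ℝ} (hκ : 0 < κ) :
    x ∈ nbhdRegionK (fun x : ℝ => x) κ x := by
  unfold nbhdRegionK
  split_ifs with h1 h2
  · rw [mem_ofPred_eq, dist_self]
    refine mul_pos hκ ((sub_pos.mpr h1).trans_le ((le_infDist ⟨0, by norm_num⟩).mpr ?_))
    intro y hy
    rw [mem_ofPred_eq] at hy
    rw [Real.dist_eq]
    exact le_trans (by linarith) (le_abs_self _)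
  · rw [mem_ofPred_eq, dist_self]
    refine mul_pos hκ ((sub_pos.mpr h2).trans_le ((le_infDist ⟨1, by norm_num⟩).mpr ?_))
    intro y hy
    rw [mem_ofPred_eq] at hy
    rw [dist_comm, Real.dist_eq]
    exact le_trans (by linarith) (le_abs_self _)
  · exact mem_singleton x

lemma mem_nbhdRegionK_id_half {Δ x c : ℝ} (hΔ : 0 < Δ)
    (hx : x ∈ Ioo (1 / 2 + 2 * Δ / 3) (1 / 2 + Δ)) (hc : c ∈ Ioo (1 / 2 + 2 * Δ / 3) (1 / 2 + Δ)) :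
    c ∈ nbhdRegionK (fun x : ℝ => x) (1 / 2) x := by
  have hx' : 1 / 2 < x := by linarith [hx.1]
  have hinf : c - 1 / 2 ≤ infDist c {z : ℝ | z ≤ 1 / 2} := by
    refine (le_infDist ⟨0, by norm_num⟩).mpr fun y hy => ?_
    rw [mem_ofPred_eq] at hy
    rw [Real.dist_eq]
    exact le_trans (by linarith) (le_abs_self _)
  rw [nbhdRegionK, if_pos hx', mem_ofPred_eq, Real.dist_eq]
  refine lt_of_lt_of_le (abs_lt.mpr ⟨?_, ?_⟩)
    (mul_le_mul_of_nonneg_left hinf (by norm_num : (0 : ℝ) ≤ 1 / 2)) <;>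
  linarith [hx.1, hx.2, hc.1, hc.2]

lemma unitUnif_Ioo {Δ : ℝ} (h0 : 0 < Δ) (h1 : Δ ≤ 1 / 2) :
    unitUnif (Ioo (1 / 2 + 2 * Δ / 3) (1 / 2 + Δ)) = ENNReal.ofReal (Δ / 3) := by
  rw [unitUnif, Measure.restrict_apply measurableSet_Ioo, inter_eq_left.mpr, Real.volume_Ioo]
  · congr 1; ring
  · exact fun x hx => ⟨by linarith [hx.1], by linarith [hx.2]⟩

/-- A nearest neighbor classifier that errs at a single point slightly to the right of the
decision boundary loses a constant amount of astuteness. -/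
lemma IsKNNClassifier.astuteness_add_le {n k : ℕ} {xs : Fin n → ℝ}
    (hxs : Function.Injective xs) {ys : Fin n → Bool} {f : ℝ → Bool}
    (hf : IsKNNClassifier k xs ys f) {Δ c : ℝ} (h0 : 0 < Δ) (h1 : Δ ≤ 1 / 2)
    (hc : c ∈ Ioo (1 / 2 + 2 * Δ / 3) (1 / 2 + Δ)) (hfc : f c = false) :
    astuteness unitUnif (fun x => x) (nbhdRegionK (fun x => x) (1 / 2)) f + Δ ^ 2 / 3 ≤
      accuracy unitUnif (fun x => x) (bayes fun x => x) := by
  obtain ⟨F, P, hF, hP, hFP⟩ := hf.exists_measurableSet hxs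
  obtain ⟨I, hI⟩ : ∃ I, I = Ioo (1 / 2 + 2 * Δ / 3) (1 / 2 + Δ) := ⟨_, rfl⟩
  have hIm : MeasurableSet I := hI ▸ measurableSet_Ioo
  let B : Set (ℝ × Bool) := F ×ˢ univ ∪ ((P \ I) ×ˢ {true} ∪ Pᶜ ×ˢ {false})
  have hB : MeasurableSet B :=
    (hF.measurableSet.prod .univ).union
      (((hP.diff hIm).prod (measurableSet_singleton _)).union
        (hP.compl.prod (measurableSet_singleton _)))
  have hsub : {p : ℝ × Bool | ∀ x' ∈ nbhdRegionK (fun x => x) (1 / 2) p.1, f x' = p.2} ⊆ B := by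
    rintro ⟨x, y⟩ hp
    simp only [mem_ofPred_eq] at hp
    by_cases hxF : x ∈ F
    · exact Or.inl ⟨hxF, mem_univ _⟩
    right
    have hfx : f x = y := hp x (self_mem_nbhdRegionK_id (by norm_num))
    cases y with
    | true =>
      refine Or.inl ⟨⟨(hFP x hxF).mp hfx, fun hxI => ?_⟩, rfl⟩
      exact absurd ((hp c (mem_nbhdRegionK_id_half h0 (hI ▸ hxI) hc)).symm.trans hfc) (by simp)
    | false =>
      refine Or.inr ⟨fun hxP => ?_, rfl⟩
      exact absurd (((hFP x hxF).mpr hxP).symm.trans hfx) (by simp)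
  have hb : Measurable (bayes fun x : ℝ => x) :=
    Measurable.ite measurableSet_Ici measurable_const measurable_const
  have hG : MeasurableSet {p : ℝ × Bool | bayes (fun x => x) p.1 = p.2} :=
    measurableSet_eq_fun (hb.comp measurable_fst) measurable_snd
  have hFnull : ∀ᵐ x ∂unitUnif, x ∉ F := by
    have : unitUnif F = 0 :=
      le_antisymm ((Measure.restrict_apply_le _ _).trans_eq (hF.measure_zero _)) zero_le
    exact measure_eq_zero_iff_ae_notMem.mp this
  have key : jointD unitUnif (fun x => x) B + ENNReal.ofReal (Δ ^ 2 / 3) ≤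
      jointD unitUnif (fun x => x) {p | bayes (fun x => x) p.1 = p.2} := by
    have hgap : ENNReal.ofReal (Δ ^ 2 / 3) =
        ∫⁻ x, I.indicator (fun _ => ENNReal.ofReal Δ) x ∂unitUnif := by
      rw [lintegral_indicator_const hIm, hI, unitUnif_Ioo h0 h1,
        ← ENNReal.ofReal_mul h0.le]
      congr 1; ring
    rw [jointD_apply _ measurable_id' hB, jointD_apply _ measurable_id' hG, hgap,
      ← lintegral_add_right _ (measurable_const.indicator hIm)]
    refine lintegral_mono_ae ?_
    filter_upwards [ae_unitUnif_mem_Icc, hFnull] with x hx hxF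
    have hbt : (bayes (fun x => x) x = true) ↔ 1 / 2 ≤ x := by simp [bayes]
    have hbf : (bayes (fun x => x) x = false) ↔ x < 1 / 2 := by simp [bayes]
    have hBt : (x, true) ∈ B ↔ x ∈ P ∧ x ∉ I := by simp [B, hxF]
    have hBf : (x, false) ∈ B ↔ x ∉ P := by simp [B, hxF]
    simp only [indicator_apply, hBt, hBf, mem_ofPred_eq, hbt, hbf, Pi.one_apply]
    by_cases hxI : x ∈ I
    · have hx1 := (hI ▸ hxI : x ∈ Ioo (1 / 2 + 2 * Δ / 3) (1 / 2 + Δ)).1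
      have hhalf : 1 / 2 ≤ x := by linarith
      have hsum : ENNReal.ofReal (1 - x) + ENNReal.ofReal Δ ≤ ENNReal.ofReal x := by
        rw [← ENNReal.ofReal_add (by linarith [hx.2]) h0.le]
        exact ENNReal.ofReal_le_ofReal (by linarith)
      have hhalf' := hhalf.not_gt
      by_cases hxP : x ∈ P <;>
        simp only [hxI, hxP, hhalf, hhalf', not_true_eq_false, not_false_eq_true, and_false,
          if_true, if_false, mul_one, mul_zero, add_zero, zero_add]
      · exact le_add_self.trans hsum
      · exact hsum
    · rcases le_or_gt (1 / 2) x with hhalf | hhalf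
      · have hhalf' := hhalf.not_gt
        by_cases hxP : x ∈ P <;>
          simp only [hxI, hxP, hhalf, hhalf', not_true_eq_false, not_false_eq_true, and_true,
            if_true, if_false, mul_one, mul_zero, add_zero, zero_add, le_refl]
        exact ENNReal.ofReal_le_ofReal (by linarith)
      · have hhalf' := hhalf.not_ge
        by_cases hxP : x ∈ P <;>
          simp only [hxI, hxP, hhalf, hhalf', not_true_eq_false, not_false_eq_true, and_true,
            if_true, if_false, mul_one, mul_zero, add_zero, zero_add, le_refl]
        exact ENNReal.ofReal_le_ofReal (by linarith)
  have key' := (ENNReal.toReal_le_toReal (by finiteness) (by finiteness)).mpr key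
  rw [ENNReal.toReal_add (by finiteness) (by finiteness),
    ENNReal.toReal_ofReal (by positivity)] at key'
  have hmono := ENNReal.toReal_mono (by finiteness)
    (measure_mono (μ := jointD unitUnif fun x => x) hsub)
  simp only [astuteness, accuracy]
  linarith

end Astuteness

section Rate

/-- With `k n = O(log n)` neighbors, a slight label bias is overwhelmed for arbitrarily large
samples. -/
lemma exists_bias_exponent (k : ℕ → ℕ) (hk : ∀ n, 0 < k n) (C : ℝ)
    (hC : ∀ n : ℕ, 2 ≤ n → (k n : ℝ) ≤ C * Real.log n) :
    ∃ Δ : ℝ, 0 < Δ ∧ Δ ≤ 1 / 2 ∧ ∀ N : ℕ, ∃ n ≥ N,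
      2 * (1 - (1 - 2 * Δ) ^ k n / 2 / k n * (Δ / 3)) ^ n ≤ 1 / 2 := by
  set K := max C 1
  have hK : 0 < K := lt_max_of_lt_right one_pos
  set Δ : ℝ := (1 - Real.exp (-(1 / (2 * K)))) / 2 with hΔ
  have hexp : 1 - 2 * Δ = Real.exp (-(1 / (2 * K))) := by rw [hΔ]; ring
  have hlt : Real.exp (-(1 / (2 * K))) < 1 := Real.exp_lt_one_iff.mpr (by
    have : 0 < 1 / (2 * K) := by positivity
    linarith)
  have hpos := Real.exp_pos (-(1 / (2 * K)))
  have h0 : 0 < Δ := by linarith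
  have h1 : Δ ≤ 1 / 2 := by linarith
  refine ⟨Δ, h0, h1, fun N => ?_⟩
  have hc : 0 < Δ / (12 * K) := by positivity
  have hlog : ∀ᶠ n : ℕ in atTop, ‖Real.log n‖ ≤ Δ / (12 * K) * ‖(n : ℝ) ^ (1 / 2 : ℝ)‖ :=
    tendsto_natCast_atTop_atTop.eventually
      ((isLittleO_log_rpow_atTop (by norm_num : (0 : ℝ) < 1 / 2)).def hc)
  obtain ⟨n, hn, hn2, hnN⟩ :=
    (hlog.and ((eventually_ge_atTop 2).and (eventually_ge_atTop N))).exists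
  refine ⟨n, hnN, ?_⟩
  have hn0 : (0 : ℝ) < n := by exact_mod_cast (by omega : 0 < n)
  have hlogpos : 0 < Real.log n := Real.log_pos (by exact_mod_cast hn2)
  set s : ℝ := (n : ℝ) ^ (1 / 2 : ℝ) with hs
  have hspos : 0 < s := Real.rpow_pos_of_pos hn0 _
  have hss : s * s = n := by rw [hs, ← Real.rpow_add hn0]; norm_num
  rw [Real.norm_of_nonneg hlogpos.le, Real.norm_of_nonneg hspos.le] at hn
  have hkK : (k n : ℝ) ≤ K * Real.log n :=
    (hC n hn2).trans (mul_le_mul_of_nonneg_right (le_max_left _ _) hlogpos.le)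
  have hk0 : (0 : ℝ) < k n := by exact_mod_cast hk n
  have hpow : 1 / s ≤ (1 - 2 * Δ) ^ k n := by
    rw [hexp, ← Real.exp_nat_mul, hs, Real.rpow_def_of_pos hn0, one_div, ← Real.exp_neg]
    refine Real.exp_le_exp.mpr ?_
    have : (k n : ℝ) * (1 / (2 * K)) ≤ Real.log n / 2 := by
      rw [mul_one_div, div_le_iff₀ (by positivity)]
      linarith
    linarith
  have hp1 : (1 - 2 * Δ) ^ k n ≤ 1 := pow_le_one₀ (by linarith) (by linarith)
  set t : ℝ := (1 - 2 * Δ) ^ k n / 2 / k n * (Δ / 3) with ht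
  have hkn : (k n : ℝ) ≤ Δ / 12 * s := by
    calc (k n : ℝ) ≤ K * Real.log n := hkK
      _ ≤ K * (Δ / (12 * K) * s) := mul_le_mul_of_nonneg_left hn hK.le
      _ = Δ / 12 * s := by field_simp
  have htn : 2 ≤ t * n := by
    have ht' : 1 / s / 2 / k n * (Δ / 3) ≤ t := by
      rw [ht]; gcongr
    have : 1 / s / 2 / k n * (Δ / 3) * n = s * (Δ / 6) / k n := by
      rw [← hss]; field_simp; ring
    have h2 : 2 ≤ s * (Δ / 6) / k n := by
      rw [le_div_iff₀ hk0]; linarith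
    nlinarith
  have ht1 : t ≤ 1 := by
    have hk1 : (1 : ℝ) ≤ k n := by exact_mod_cast hk n
    have h2 : (1 - 2 * Δ) ^ k n / 2 / k n ≤ 1 :=
      (div_le_self (by rw [hexp]; positivity) hk1).trans (by linarith)
    calc t ≤ 1 * 1 := mul_le_mul h2 (by linarith) (by positivity) one_pos.le
      _ = 1 := one_mul 1
  have hexp2 : Real.exp (-2) ≤ 1 / 4 := by
    rw [Real.exp_neg, one_div]
    refine inv_anti₀ (by norm_num) ?_
    have := Real.quadratic_le_exp_of_nonneg (x := 2) (by norm_num)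
    linarith
  calc 2 * (1 - t) ^ n ≤ 2 * Real.exp (-t) ^ n := by
        gcongr
        exact Real.one_sub_le_exp_neg t
    _ = 2 * Real.exp (-(t * n)) := by rw [← Real.exp_nat_mul]; ring_nf
    _ ≤ 2 * Real.exp (-2) := by gcongr
    _ ≤ 1 / 2 := by linarith

end Rate

section Statements

open MeasureTheory Metric Set Filter Topology
open scoped ENNReal Classical

/-- for the uniform distribution on `[0,1]` with `η(x) = x`, if
`k_n = O(log n)` then `k_n`-nearest neighbors is not neighborhood consistent. -/
theorem stmt2 (k : ℕ → ℕ) (hk : ∀ n, 0 < k n) (C : ℝ)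
    (hC : ∀ n : ℕ, 2 ≤ n → (k n : ℝ) ≤ C * Real.log n) :
    ∃ ε ∈ Ioo (0:ℝ) 1, ∃ κ ∈ Ioo (0:ℝ) 1, ∀ N : ℕ, ∃ n ≥ N,
      (1/2 : ℝ≥0∞) ≤ sampleD (volume.restrict (Icc (0:ℝ) 1)) (fun x => x) n
        {S | ∀ f : ℝ → Bool,
          IsKNNClassifier (k n) (fun j => (S j).1) (fun j => (S j).2) f →
          astuteness (volume.restrict (Icc (0:ℝ) 1)) (fun x => x)
              (nbhdRegionK (fun x => x) κ) f <
            accuracy (volume.restrict (Icc (0:ℝ) 1)) (fun x => x)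
              (bayes (fun x => x)) - ε} := by
  obtain ⟨Δ, h0, h1, hΔ⟩ := exists_bias_exponent k hk C hC
  refine ⟨Δ ^ 2 / 6, ⟨by positivity, by nlinarith⟩, 1 / 2, ⟨by norm_num, by norm_num⟩, fun N => ?_⟩
  obtain ⟨n, hnN, hn⟩ := hΔ N
  refine ⟨n, hnN, ?_⟩
  change 1 / 2 ≤ sampleD unitUnif (fun x => x) n _
  rw [sampleD_unitUnif_eq_map]
  refine le_trans ?_ (Measure.le_map_apply measurable_sampleOf.aemeasurable _)
  set I := Ioo (1 / 2 + 2 * Δ / 3) (1 / 2 + Δ) with hI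
  have hreal : unitUnif.real I = Δ / 3 := by
    rw [Measure.real, unitUnif_Ioo h0 h1, ENNReal.toReal_ofReal (by positivity)]
  have hsmall : ((Measure.pi fun _ : Fin n => unitUnif).prod
      (Measure.pi fun _ : Fin n => symUnif)) (noNegBlock (k n) Δ I) ≤ 1 / 2 := by
    refine (prod_noNegBlock_le (hk n) h0.le h1 ordConnected_Ioo isOpen_Ioo).trans ?_
    rw [hreal, Fintype.card_fin]
    refine (ENNReal.ofReal_le_ofReal hn).trans_eq ?_
    rw [ENNReal.ofReal_div_of_pos two_pos, ENNReal.ofReal_one, ENNReal.ofReal_ofNat]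
  have hlarge : 1 / 2 ≤ ((Measure.pi fun _ : Fin n => unitUnif).prod
      (Measure.pi fun _ : Fin n => symUnif)) (noNegBlock (k n) Δ I)ᶜ := by
    rw [prob_compl_eq_one_sub (measurableSet_noNegBlock _ _ isOpen_Ioo)]
    refine le_trans ?_ (tsub_le_tsub_left hsmall 1)
    rw [one_div, ENNReal.one_sub_inv_two]
  refine hlarge.trans (measure_mono_ae ?_)
  filter_upwards [Measure.quasiMeasurePreserving_fst.ae
    (ae_injective_pi_unitUnif (ι := Fin n))] with z hinj hz f hf
  obtain ⟨T, hTcard, hTI, ⟨c, hc, hstrict⟩, hv⟩ : ∃ T : Finset (Fin n), T.card = k n ∧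
      (∀ i ∈ T, z.1 i ∈ I) ∧ (∃ c ∈ I, StrictNearest z.1 T c) ∧ z.2 ∈ votesNeg Δ T := by
    by_contra! hcon
    exact hz fun T h2 h3 ⟨c, hcI, hcs⟩ => hcon T h2 h3 ⟨c, hcI, hcs⟩
  have hfc : f c = false := by
    obtain ⟨T', hcard', hnear', hvote'⟩ := hf c
    have hkn : k n ≤ n := by
      rw [← hTcard]; exact (Finset.card_le_univ T).trans_eq (Fintype.card_fin n)
    obtain rfl : T' = T :=
      hstrict.eq_of_card_eq hnear' (by rw [hcard', hTcard, min_eq_left hkn])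
    have hlabel : ∀ i ∈ T', (sampleOf z i).2 = decide (z.2 i < 0) := by
      intro i hi
      have hxi := hTI i hi
      have hvi := hv.1 i hi
      refine decide_eq_decide.mpr ⟨fun h => ?_, fun h => ?_⟩
      · by_contra! hle
        rw [abs_of_nonneg hle] at hvi
        have := hxi.2
        simp only at h
        linarith
      · have := hxi.1
        simp only
        linarith
    rw [← Bool.not_eq_true, hvote',
      Finset.sum_congr rfl fun i hi => congrArg labelVal (hlabel i hi)]
    exact hv.2.not_gt
  have hle := hf.astuteness_add_le hinj h0 h1 hc hfc
  have : 0 < Δ ^ 2 := by positivity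
  exact lt_sub_iff_add_lt.mpr (by
    change astuteness unitUnif _ _ _ + _ < accuracy unitUnif _ _
    linarith)

end Statements
end

section
/- Let D = (μ, η) be the data distribution over ℝ × {±1} where μ is the uniform distribution over [0,1] and η(x) = x. Let C be a constant with k_n ≤ C·log n for all n ≥ 2, and let f_n denote the k_n-nearest neighbor classifier learned from S ∼ D^n. Then there exists a constant Δ > 0 such that for all sufficiently large n, with probability at least 1/2 over S ∼ D^n, there exists x ∈ [1/2 − Δ, 1/2 − 3Δ/4] with f_n(x) = +1. -/
open MeasureTheory Metric Set Filter Topology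
open scoped ENNReal Classical

section MajorityVote

lemma labelVal_not (b : Bool) : labelVal (!b) = -labelVal b := by
  cases b <;> simp [labelVal]

/-- At least a quarter of all sign vectors have a strictly positive sum. -/
lemma two_pow_card_le_four_mul_card_majority {ι : Type*} [Fintype ι] [DecidableEq ι] [Nonempty ι] :
    2 ^ Fintype.card ι ≤
      4 * (Finset.univ.filter fun z : ι → Bool => 0 < ∑ i, labelVal (z i)).card := by
  set M := Finset.univ.filter fun z : ι → Bool => 0 < ∑ i, labelVal (z i) with hM
  obtain ⟨t⟩ := ‹Nonempty ι›
  let flipAt : (ι → Bool) → ι → Bool := fun z => Function.update z t (!z t)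
  let flipOff : (ι → Bool) → ι → Bool := fun z i => if i = t then z i else !z i
  have hAt (z) : flipAt (flipAt z) = z := by simp [flipAt]
  have hOff (z) : flipOff (flipOff z) = z := by
    ext i; by_cases h : i = t <;> simp [flipOff, h]
  have key (z : ι → Bool) (hz : z t = true) : z ∈ M ∨ flipOff z ∈ M := by
    have h1 : ∑ i, labelVal (z i) = 1 + ∑ i ∈ Finset.univ.erase t, labelVal (z i) := by
      rw [← Finset.add_sum_erase _ _ (Finset.mem_univ t), hz]; simp [labelVal]
    have h2 : ∑ i, labelVal (flipOff z i) = 1 - ∑ i ∈ Finset.univ.erase t, labelVal (z i) := by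
      rw [← Finset.add_sum_erase _ _ (Finset.mem_univ t), sub_eq_add_neg,
        ← Finset.sum_neg_distrib]
      congr 1
      · simp [flipOff, hz, labelVal]
      · refine Finset.sum_congr rfl fun i hi => ?_
        rw [← labelVal_not]; simp [flipOff, Finset.ne_of_mem_erase hi]
    simp only [hM, Finset.mem_filter, Finset.mem_univ, true_and, h1, h2]
    by_contra! h
    linarith
  have hcover : (Finset.univ : Finset (ι → Bool)) ⊆
      (M ∪ M.image flipOff) ∪ (M.image flipAt ∪ M.image (flipAt ∘ flipOff)) := by
    intro z _
    simp only [Finset.mem_union, Finset.mem_image, Function.comp]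
    by_cases hz : z t = true
    · rcases key z hz with h | h
      · exact .inl (.inl h)
      · exact .inl (.inr ⟨_, h, hOff z⟩)
    · have hz' : flipAt z t = true := by simpa [flipAt] using hz
      rcases key _ hz' with h | h
      · exact .inr (.inl ⟨_, h, hAt z⟩)
      · exact .inr (.inr ⟨_, h, by rw [hOff, hAt]⟩)
  have h1 := Finset.card_le_card hcover
  have h2 := Finset.card_union_le (M ∪ M.image flipOff) (M.image flipAt ∪ M.image (flipAt ∘ flipOff))
  have h3 := Finset.card_union_le M (M.image flipOff)
  have h4 := Finset.card_union_le (M.image flipAt) (M.image (flipAt ∘ flipOff))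
  have h5 := Finset.card_image_le (s := M) (f := flipOff)
  have h6 := Finset.card_image_le (s := M) (f := flipAt)
  have h7 := Finset.card_image_le (s := M) (f := flipAt ∘ flipOff)
  have h8 : (Finset.univ : Finset (ι → Bool)).card = 2 ^ Fintype.card ι := by simp
  omega

lemma measure_majority_ge {ι : Type*} [Fintype ι] [Nonempty ι]
    (ν : Measure Bool) [IsProbabilityMeasure ν] (p : ℝ≥0∞) (hp : ∀ b, p ≤ ν {b}) :
    (2 * p) ^ Fintype.card ι / 4 ≤
      Measure.pi (fun _ : ι => ν) {z | 0 < ∑ i, labelVal (z i)} := by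
  classical
  set M := Finset.univ.filter fun z : ι → Bool => 0 < ∑ i, labelVal (z i) with hM
  have hset : {z : ι → Bool | 0 < ∑ i, labelVal (z i)} = (M : Set (ι → Bool)) := by
    ext; simp [hM]
  rw [hset, ← sum_measure_singleton]
  have hle : M.card * p ^ Fintype.card ι ≤ ∑ z ∈ M, Measure.pi (fun _ : ι => ν) {z} := by
    rw [← nsmul_eq_mul]
    refine Finset.card_nsmul_le_sum _ _ _ fun z _ => ?_
    rw [Measure.pi_singleton, Fintype.card, ← Finset.prod_const]
    exact Finset.prod_le_prod' fun i _ => hp _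
  refine le_trans ?_ hle
  rw [ENNReal.div_le_iff (by norm_num) (by norm_num), mul_pow, mul_right_comm]
  gcongr
  rw [mul_comm]
  exact_mod_cast two_pow_card_le_four_mul_card_majority

lemma map_curry_pi {α β γ : Type*} [Fintype α] [Fintype β] [MeasurableSpace γ] [Countable γ]
    [MeasurableSingletonClass γ] (ν : Measure γ) [IsProbabilityMeasure ν] :
    (Measure.pi fun _ : α × β => ν).map (fun z (a : α) (b : β) => z (a, b)) =
      Measure.pi fun _ => Measure.pi fun _ => ν := by
  refine Measure.ext_of_singleton fun w => ?_
  have hpre : (fun (z : α × β → γ) a b => z (a, b)) ⁻¹' {w} = {fun q => w q.1 q.2} := by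
    ext z
    simp [funext_iff]
  rw [Measure.map_apply (by fun_prop) (measurableSet_singleton _), hpre]
  simp_rw [Measure.pi_singleton, Fintype.prod_prod_type]

lemma map_comp_pi {ι κ γ : Type*} [Fintype ι] [Fintype κ] [MeasurableSpace γ]
    (ν : Measure γ) [IsProbabilityMeasure ν] {e : κ → ι} (he : e.Injective) :
    (Measure.pi fun _ : ι => ν).map (fun z q => z (e q)) = Measure.pi fun _ => ν := by
  have h : ProbabilityTheory.iIndepFun (fun q (z : ι → γ) => z (e q)) (Measure.pi fun _ => ν) :=
    (ProbabilityTheory.iIndepFun_pi (μ := fun _ : ι => ν) (X := fun _ => id)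
      fun _ => aemeasurable_id).precomp he
  rw [ProbabilityTheory.iIndepFun_iff_map_fun_eq_pi_map
    (f := fun q (z : ι → γ) => z (e q)) (fun q => (measurable_pi_apply (e q)).aemeasurable)] at h
  simpa [(measurePreserving_eval (fun _ : ι => ν) _).map_eq] using h

/-- Majority votes over disjoint groups of i.i.d. labels fail simultaneously with probability
exponentially small in the number of groups. -/
lemma measure_forall_not_majority_le {ι : Type*} [Fintype ι] {m k : ℕ} (hk : 0 < k)
    (ν : Measure Bool) [IsProbabilityMeasure ν] (p : ℝ≥0∞) (hp : ∀ b, p ≤ ν {b})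
    (T : Fin m → Finset ι) (hcard : ∀ j, (T j).card = k)
    (hdisj : Pairwise fun a b => Disjoint (T a) (T b)) :
    Measure.pi (fun _ : ι => ν) {z | ∀ j, ¬ 0 < ∑ i ∈ T j, labelVal (z i)} ≤
      (1 - (2 * p) ^ k / 4) ^ m := by
  let e (q : Fin m × Fin k) : ι := (T q.1).equivFinOfCardEq (hcard q.1) |>.symm q.2
  have he : e.Injective := by
    rintro ⟨a, l⟩ ⟨b, l'⟩ h
    have hab : a = b := by
      by_contra hne
      have hb : e (a, l) ∈ T b := by rw [h]; exact Subtype.prop _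
      exact Finset.disjoint_left.1 (hdisj hne) (Subtype.prop _) hb
    subst hab
    simpa [e, Subtype.val_inj] using h
  have hsum (z : ι → Bool) (j) : ∑ i ∈ T j, labelVal (z i) = ∑ l, labelVal (z (e (j, l))) := by
    rw [← Finset.sum_coe_sort]
    exact (Equiv.sum_comp ((T j).equivFinOfCardEq (hcard j)).symm
      fun i : T j => labelVal (z i)).symm
  have : NeZero k := ⟨hk.ne'⟩
  set A : Set (Fin k → Bool) := {z | 0 < ∑ l, labelVal (z l)}
  have hset : {z : ι → Bool | ∀ j, ¬ 0 < ∑ i ∈ T j, labelVal (z i)} =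
      (fun (z : ι → Bool) q => z (e q)) ⁻¹'
        ((fun (z : Fin m × Fin k → Bool) a b => z (a, b)) ⁻¹' Set.univ.pi fun _ => Aᶜ) := by
    ext z
    simp [A, hsum]
  rw [hset, ← Measure.map_apply (by fun_prop) (Set.toFinite _).measurableSet, map_comp_pi ν he,
    ← Measure.map_apply (by fun_prop) (Set.toFinite _).measurableSet, map_curry_pi,
    Measure.pi_pi, Finset.prod_const, Finset.card_univ, Fintype.card_fin]
  gcongr
  rw [prob_compl_eq_one_sub (Set.toFinite _).measurableSet]
  gcongr
  simpa using measure_majority_ge (ι := Fin k) ν p hp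

end MajorityVote

section NearestNeighbors

variable {E : Type*} [PseudoMetricSpace E] {ι : Type*}

/-- A set of nearest neighbors of `x` with at most as many elements as there are sample points in
a ball around `x` is contained in that ball. -/
lemma nearest_mem_ball [Fintype ι] {x : E} {xs : ι → E} {r : ℝ} {T : Finset ι}
    (hT : ∀ i ∈ T, ∀ j ∉ T, dist x (xs i) ≤ dist x (xs j))
    (hcard : T.card ≤ (Finset.univ.filter fun i => xs i ∈ ball x r).card) {i : ι} (hi : i ∈ T) :
    xs i ∈ ball x r := by
  by_contra hir
  have hsub : (Finset.univ.filter fun i => xs i ∈ ball x r) ⊂ T := by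
    rw [Finset.ssubset_iff_of_subset]
    · exact ⟨i, hi, by simpa using hir⟩
    · intro j hj
      by_contra hjT
      simp only [Finset.mem_filter, mem_ball'] at hj hir
      exact hir ((hT i hi j hjT).trans_lt hj.2)
  exact absurd (Finset.card_lt_card hsub) (not_lt.2 hcard)

/-- In the absence of distance ties a set of nearest neighbors is determined by its size. -/
lemma nearest_unique {x : E} {xs : ι → E} {T T' : Finset ι}
    (hne : Pairwise fun i j => dist x (xs i) ≠ dist x (xs j))
    (hT : ∀ i ∈ T, ∀ j ∉ T, dist x (xs i) ≤ dist x (xs j))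
    (hT' : ∀ i ∈ T', ∀ j ∉ T', dist x (xs i) ≤ dist x (xs j))
    (hcard : T.card = T'.card) : T = T' := by
  refine Finset.eq_of_subset_of_card_le (fun i hi => ?_) hcard.ge
  by_contra hi'
  have hnot : ¬ T' ⊆ T := fun h => hi' (Finset.eq_of_subset_of_card_le h hcard.le ▸ hi)
  obtain ⟨j, hj', hj⟩ := Finset.not_subset.1 hnot
  exact hne (fun h : i = j => hj (h ▸ hi)) (le_antisymm (hT i hi j hj) (hT' j hj' i hi'))

end NearestNeighbors

section SampleProbabilities

lemma measure_card_mem_lt_le {α ι : Type*} [Fintype ι] [MeasurableSpace α] (μ : Measure α)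
    [IsProbabilityMeasure μ] {B : Set α} (hB : MeasurableSet B) (k : ℕ) :
    Measure.pi (fun _ : ι => μ) {xs | (Finset.univ.filter fun i => xs i ∈ B).card < k} ≤
      2 ^ k * (μ B / 2 + μ Bᶜ) ^ Fintype.card ι := by
  set g : α → ℝ≥0∞ := fun x => if x ∈ B then 2⁻¹ else 1 with hg
  have hgm : Measurable g := Measurable.ite hB measurable_const measurable_const
  have hgi : ∫⁻ x, g x ∂μ = μ B / 2 + μ Bᶜ := by
    rw [← lintegral_add_compl g hB,
      setLIntegral_congr_fun hB (g := fun _ => 2⁻¹) fun x hx => if_pos hx,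
      setLIntegral_congr_fun hB.compl (g := fun _ => 1) fun x hx => if_neg hx]
    simp [div_eq_mul_inv, mul_comm]
  have hprod : ∫⁻ xs, ∏ i, g (xs i) ∂Measure.pi (fun _ : ι => μ) =
      (μ B / 2 + μ Bᶜ) ^ Fintype.card ι := by
    rw [ProbabilityTheory.lintegral_prod_eq_prod_lintegral_of_indepFun Finset.univ
      (fun i (xs : ι → α) => g (xs i))
      (ProbabilityTheory.iIndepFun_pi fun _ => hgm.aemeasurable) (fun i => by fun_prop)]
    simp_rw [(measurePreserving_eval (fun _ : ι => μ) _).lintegral_comp hgm, hgi]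
    simp
  have hmarkov := mul_meas_ge_le_lintegral (μ := Measure.pi fun _ : ι => μ)
    (f := fun xs => ∏ i, g (xs i)) (by fun_prop) (2⁻¹ ^ k)
  rw [hprod] at hmarkov
  calc _ = 2 ^ k * (2⁻¹ ^ k *
        Measure.pi (fun _ : ι => μ) {xs | (Finset.univ.filter fun i => xs i ∈ B).card < k}) := by
        rw [← mul_assoc, ← mul_pow, ENNReal.mul_inv_cancel (by simp) (by simp), one_pow, one_mul]
    _ ≤ 2 ^ k * (μ B / 2 + μ Bᶜ) ^ Fintype.card ι := mul_le_mul_right (le_trans ?_ hmarkov) _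
  gcongr with xs
  intro hxs
  rw [Finset.prod_ite, Finset.prod_const, Finset.prod_const_one, mul_one]
  exact pow_le_pow_right_of_le_one' (by simp) hxs.le

lemma measure_dist_tie_eq_zero {ι : Type*} [Fintype ι] (μ : Measure ℝ) [IsProbabilityMeasure μ]
    [NullSingletonClass μ] (c : ℝ) {i j : ι} (hij : i ≠ j) :
    Measure.pi (fun _ : ι => μ) {xs | dist c (xs i) = dist c (xs j)} = 0 := by
  have hind : ProbabilityTheory.IndepFun (fun xs : ι → ℝ => xs i) (fun xs => xs j)
      (Measure.pi fun _ => μ) :=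
    (ProbabilityTheory.iIndepFun_pi (μ := fun _ : ι => μ) (X := fun _ => id)
      fun _ => aemeasurable_id).indepFun hij
  rw [ProbabilityTheory.indepFun_iff_map_prod_eq_prod_map_map
    (measurable_pi_apply i).aemeasurable (measurable_pi_apply j).aemeasurable] at hind
  simp only [(measurePreserving_eval (fun _ : ι => μ) _).map_eq] at hind
  have hm : MeasurableSet {q : ℝ × ℝ | dist c q.1 = dist c q.2} :=
    measurableSet_eq_fun (by fun_prop) (by fun_prop)
  have hnull : (μ.prod μ) {q : ℝ × ℝ | dist c q.1 = dist c q.2} = 0 := by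
    rw [Measure.measure_prod_null hm]
    refine .of_forall fun x => measure_mono_null (t := {x, 2 * c - x}) (fun y hy => ?_)
      (Set.Finite.measure_zero (by simp) μ)
    have hy : |c - x| = |c - y| := hy
    rcases abs_eq_abs.1 hy with h | h
    · left; linarith
    · right; rw [Set.mem_singleton_iff]; linarith
  rw [← hind, Measure.map_apply (by fun_prop) hm] at hnull
  exact hnull

instance isProbabilityMeasure_volume_restrict_Icc_zero_one :
    IsProbabilityMeasure (volume.restrict (Icc (0 : ℝ) 1)) := ⟨by simp⟩

lemma volume_restrict_Icc_Iio {x : ℝ} (hx : x ∈ Icc (0 : ℝ) 1) :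
    volume.restrict (Icc (0 : ℝ) 1) (Iio x) = ENNReal.ofReal x := by
  rw [Measure.restrict_apply measurableSet_Iio]
  have : Iio x ∩ Icc 0 1 = Ico 0 x := by
    ext y; simp only [mem_inter_iff, mem_Iio, mem_Icc, mem_Ico]
    exact ⟨fun h => ⟨h.2.1, h.1⟩, fun h => ⟨h.2, h.1, h.2.le.trans hx.2⟩⟩
  simp [this]

lemma volume_restrict_Icc_Ici {x : ℝ} (hx : x ∈ Icc (0 : ℝ) 1) :
    volume.restrict (Icc (0 : ℝ) 1) (Ici x) = ENNReal.ofReal (1 - x) := by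
  rw [← compl_Iio, prob_compl_eq_one_sub measurableSet_Iio, volume_restrict_Icc_Iio hx,
    ENNReal.ofReal_sub _ hx.1, ENNReal.ofReal_one]

lemma measurable_prodMk_decide_lt :
    Measurable fun q : ℝ × ℝ => (q.1, decide (q.2 < q.1)) :=
  measurable_fst.prodMk <| measurable_to_bool <| by
    have : (fun q : ℝ × ℝ => decide (q.2 < q.1)) ⁻¹' {true} = {q | q.2 < q.1} := by ext; simp
    rw [this]
    exact measurableSet_lt measurable_snd measurable_fst

/-- Sampling a label that is `+1` with probability `x` amounts to comparing an independent uniform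
variable with `x`. -/
lemma jointD_uniform_eq_map :
    jointD (volume.restrict (Icc (0 : ℝ) 1)) (fun x => x) =
      ((volume.restrict (Icc (0 : ℝ) 1)).prod (volume.restrict (Icc (0 : ℝ) 1))).map
        fun q => (q.1, decide (q.2 < q.1)) := by
  ext s hs
  have hker : Measurable fun x : ℝ => ENNReal.ofReal x • Measure.dirac (x, true) +
      ENNReal.ofReal (1 - x) • Measure.dirac (x, false) := by
    refine Measure.measurable_of_measurable_coe _ fun t ht => ?_
    simp only [Measure.coe_add, Measure.coe_smul, Pi.add_apply, Pi.smul_apply, smul_eq_mul,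
      Measure.dirac_apply' _ ht]
    have h (b : Bool) : Measurable fun x : ℝ => t.indicator (1 : ℝ × Bool → ℝ≥0∞) (x, b) :=
      (measurable_one.indicator ht).comp measurable_prodMk_right
    have := h true
    have := h false
    fun_prop
  rw [jointD, Measure.bind_apply hs hker.aemeasurable,
    Measure.map_apply measurable_prodMk_decide_lt hs,
    Measure.prod_apply (measurable_prodMk_decide_lt hs)]
  refine lintegral_congr_ae ?_
  filter_upwards [ae_restrict_mem measurableSet_Icc] with x hx
  have hpre : Prod.mk x ⁻¹' ((fun q : ℝ × ℝ => (q.1, decide (q.2 < q.1))) ⁻¹' s) =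
      {u | u < x ∧ (x, true) ∈ s} ∪ {u | x ≤ u ∧ (x, false) ∈ s} := by
    ext u
    rcases lt_or_ge u x with h | h <;> simp [h, not_le.2, not_lt.2]
  simp only [Measure.coe_add, Measure.coe_smul, Pi.add_apply, Pi.smul_apply, smul_eq_mul,
    Measure.dirac_apply' _ hs, hpre]
  have h1 := volume_restrict_Icc_Iio hx
  have h2 := volume_restrict_Icc_Ici hx
  have h3 : ENNReal.ofReal x + ENNReal.ofReal (1 - x) = 1 := by
    rw [← ENNReal.ofReal_add hx.1 (by linarith [hx.2])]; simp
  have h4 : {u | u < x} ∪ {u | x ≤ u} = univ := by ext u; simpa using lt_or_ge u x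
  by_cases ht : (x, true) ∈ s <;> by_cases hf : (x, false) ∈ s
  · simp only [ht, hf, and_true, Set.indicator_of_mem, Pi.one_apply, mul_one, h3, h4, measure_univ]
  · simpa [ht, hf, Iio] using h1.symm
  · simpa [ht, hf, Ici] using h2.symm
  · simp [ht, hf]

end SampleProbabilities

section FailureProbability

lemma labelVal_mono {a b : Bool} (h : a = true → b = true) : labelVal a ≤ labelVal b := by
  cases a <;> cases b <;> simp_all [labelVal]

/-- The sample fails if, for each of the query points `c j`, some choice of `k` nearest neighbors
has no strict majority of points whose auxiliary uniform variable is below `p`. -/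
def majorityFailure {m n : ℕ} (k : ℕ) (p : ℝ) (c : Fin m → ℝ) :
    Set ((Fin n → ℝ) × (Fin n → ℝ)) :=
  {q | ∀ j, ∃ T : Finset (Fin n), T.card = k ∧
    (∀ i ∈ T, ∀ l ∉ T, dist (c j) (q.1 i) ≤ dist (c j) (q.1 l)) ∧
    ¬ 0 < ∑ i ∈ T, labelVal (decide (q.2 i < p))}

lemma measurable_decide_lt (p : ℝ) : Measurable fun u : ℝ => decide (u < p) :=
  measurable_to_bool <| by
    have : (fun u : ℝ => decide (u < p)) ⁻¹' {true} = Iio p := by ext; simp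
    rw [this]
    exact measurableSet_Iio

lemma measurableSet_majorityFailure {m n : ℕ} (k : ℕ) (p : ℝ) (c : Fin m → ℝ) :
    MeasurableSet (majorityFailure (n := n) k p c) := by
  have hlab (i : Fin n) : Measurable fun q : (Fin n → ℝ) × (Fin n → ℝ) =>
      labelVal (decide (q.2 i < p)) :=
    (measurable_of_countable labelVal).comp
      ((measurable_decide_lt p).comp ((measurable_pi_apply i).comp measurable_snd))
  refine measurableSet_setOfPred.2 (.forall fun j => .exists fun T =>
    .and measurable_const (.and ?_ (.not ?_)))
  · exact .forall fun i => .imp measurable_const (.forall fun l => .imp measurable_const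
      (measurableSet_setOfPred.1 (measurableSet_le (by fun_prop) (by fun_prop))))
  · exact measurableSet_setOfPred.1
      (measurableSet_lt measurable_const (Finset.measurable_fun_sum _ fun i _ => hlab i))

lemma measure_majorityFailure_section_le {m n k : ℕ} (hk : 0 < k) {p : ℝ} (hp : 0 ≤ p)
    (hp' : p ≤ 1 / 2) {c : Fin m → ℝ} {w : ℝ}
    (hdisj : Pairwise fun a b => Disjoint (ball (c a) w) (ball (c b) w)) {xs : Fin n → ℝ}
    (hcard : ∀ j, k ≤ (Finset.univ.filter fun i => xs i ∈ ball (c j) w).card)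
    (hne : ∀ j, Pairwise fun i l => dist (c j) (xs i) ≠ dist (c j) (xs l)) :
    Measure.pi (fun _ : Fin n => volume.restrict (Icc (0 : ℝ) 1))
        (Prod.mk xs ⁻¹' majorityFailure k p c) ≤
      (1 - (2 * ENNReal.ofReal p) ^ k / 4) ^ m := by
  rcases (Prod.mk xs ⁻¹' majorityFailure k p c).eq_empty_or_nonempty with h | ⟨u₀, hu₀⟩
  · simp [h]
  choose T hTk hT _ using hu₀
  set ν := (volume.restrict (Icc (0 : ℝ) 1)).map fun u => decide (u < p)
  have hν : IsProbabilityMeasure ν :=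
    Measure.isProbabilityMeasure_map (measurable_decide_lt p).aemeasurable
  have hpI : p ∈ Icc (0 : ℝ) 1 := ⟨hp, by linarith⟩
  have hpν (b : Bool) : ENNReal.ofReal p ≤ ν {b} := by
    rw [Measure.map_apply (measurable_decide_lt p) (measurableSet_singleton _)]
    cases b
    · have : (fun u : ℝ => decide (u < p)) ⁻¹' {false} = Ici p := by ext; simp
      rw [this, volume_restrict_Icc_Ici hpI]
      exact ENNReal.ofReal_le_ofReal (by linarith)
    · have : (fun u : ℝ => decide (u < p)) ⁻¹' {true} = Iio p := by ext; simp
      rw [this, volume_restrict_Icc_Iio hpI]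
  have hTdisj : Pairwise fun a b => Disjoint (T a) (T b) := fun a b hab =>
    Finset.disjoint_left.2 fun i ha hb => Set.disjoint_left.1 (hdisj hab)
      (nearest_mem_ball (hT a) ((hTk a).trans_le (hcard a)) ha)
      (nearest_mem_ball (hT b) ((hTk b).trans_le (hcard b)) hb)
  refine le_trans (measure_mono ?_) <|
    (Measure.le_map_apply (f := fun (u : Fin n → ℝ) i => decide (u i < p))
      (measurable_pi_lambda _ fun i =>
        (measurable_decide_lt p).comp (measurable_pi_apply i)).aemeasurable
      {z | ∀ j, ¬ 0 < ∑ i ∈ T j, labelVal (z i)}).trans ?_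
  · intro u hu j
    obtain ⟨T', hT'k, hT', hlab⟩ := hu j
    rwa [nearest_unique (hne j) hT' (hT j) (hT'k.trans (hTk j).symm)] at hlab
  · rw [Measure.pi_map_pi fun _ => (measurable_decide_lt p).aemeasurable]
    exact measure_forall_not_majority_le hk ν _ hpν T hTk hTdisj

lemma sampleD_uniform_ge {n : ℕ} (s : Set (Fin n → ℝ × Bool)) :
    ((Measure.pi fun _ : Fin n => volume.restrict (Icc (0 : ℝ) 1)).prod
      (Measure.pi fun _ : Fin n => volume.restrict (Icc (0 : ℝ) 1)))
        {q | (fun i => (q.1 i, decide (q.2 i < q.1 i))) ∈ s} ≤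
      sampleD (volume.restrict (Icc (0 : ℝ) 1)) (fun x => x) n s := by
  have hm : AEMeasurable (fun q : ℝ × ℝ => (q.1, decide (q.2 < q.1)))
      ((volume.restrict (Icc (0 : ℝ) 1)).prod (volume.restrict (Icc (0 : ℝ) 1))) :=
    measurable_prodMk_decide_lt.aemeasurable
  have := Measure.isProbabilityMeasure_map hm
  rw [sampleD, jointD_uniform_eq_map, ← Measure.pi_map_pi fun _ => hm,
    ← (measurePreserving_arrowProdEquivProdArrow ℝ ℝ (Fin n) _ _).measure_preimage_equiv]
  refine le_trans (le_of_eq rfl) (Measure.le_map_apply (measurable_pi_lambda _ fun i =>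
    measurable_prodMk_decide_lt.comp (measurable_pi_apply i)).aemeasurable s)

/-- If disjoint balls of radius `w` around `c j` lie in `[p, 1]`, then the `k`-nearest neighbor
rule fails to predict `+1` at every `c j` only if some ball receives few sample points or all the
majority votes are negative. -/
lemma le_sampleD_exists_knn_eq_true {m n k : ℕ} (hk : 0 < k) (hkn : k ≤ n) {p : ℝ} (hp : 0 ≤ p)
    (hp' : p ≤ 1 / 2) {c : Fin m → ℝ} {w : ℝ} (hw : 0 ≤ w)
    (hdisj : Pairwise fun a b => Disjoint (ball (c a) w) (ball (c b) w))
    (hsub : ∀ j, ball (c j) w ⊆ Icc p 1) :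
    1 - (m * (2 ^ k * ENNReal.ofReal (1 - w) ^ n) + (1 - (2 * ENNReal.ofReal p) ^ k / 4) ^ m) ≤
      sampleD (volume.restrict (Icc (0 : ℝ) 1)) (fun x => x) n
        {S | ∀ f : ℝ → Bool, IsKNNClassifier k (fun j => (S j).1) (fun j => (S j).2) f →
          ∃ j, f (c j) = true} := by
  set μ := volume.restrict (Icc (0 : ℝ) 1) with hμ
  set P := Measure.pi fun _ : Fin n => μ with hP
  set s := {S : Fin n → ℝ × Bool | ∀ f : ℝ → Bool,
    IsKNNClassifier k (fun j => (S j).1) (fun j => (S j).2) f → ∃ j, f (c j) = true}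
  refine le_trans ?_ (sampleD_uniform_ge s)
  set s' := {q : (Fin n → ℝ) × (Fin n → ℝ) | (fun i => (q.1 i, decide (q.2 i < q.1 i))) ∈ s}
  set G := {xs : Fin n → ℝ |
    (∀ j, k ≤ (Finset.univ.filter fun i => xs i ∈ ball (c j) w).card) ∧
    ∀ j, Pairwise fun i l => dist (c j) (xs i) ≠ dist (c j) (xs l)}
  have hball (j : Fin m) : μ (ball (c j) w) / 2 + μ (ball (c j) w)ᶜ = ENNReal.ofReal (1 - w) := by
    have hsub' : ball (c j) w ⊆ Icc 0 1 := (hsub j).trans (Icc_subset_Icc_left hp)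
    have hvol : μ (ball (c j) w) = ENNReal.ofReal (2 * w) := by
      rw [hμ, Measure.restrict_apply measurableSet_ball, inter_eq_self_of_subset_left hsub',
        Real.volume_ball]
    have hle : 2 * w ≤ 1 := by
      have h := prob_le_one (μ := μ) (s := ball (c j) w)
      rwa [hvol, ENNReal.ofReal_le_one] at h
    rw [prob_compl_eq_one_sub measurableSet_ball, hvol, ← ENNReal.ofReal_one,
      ← ENNReal.ofReal_sub _ (by positivity), ← ENNReal.ofReal_ofNat 2,
      ← ENNReal.ofReal_div_of_pos two_pos, ← ENNReal.ofReal_add (by positivity) (by linarith)]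
    congr 1; ring
  have hG : P Gᶜ ≤ m * (2 ^ k * ENNReal.ofReal (1 - w) ^ n) := by
    have hcover : Gᶜ ⊆ (⋃ j, {xs : Fin n → ℝ |
          (Finset.univ.filter fun i => xs i ∈ ball (c j) w).card < k}) ∪
        ⋃ j, ⋃ i, ⋃ l, ⋃ _ : i ≠ l, {xs : Fin n → ℝ | dist (c j) (xs i) = dist (c j) (xs l)} := by
      intro xs hxs
      by_contra hcon
      simp only [mem_union, mem_iUnion, mem_ofPred_eq, not_or, not_exists, not_lt] at hcon
      exact hxs ⟨hcon.1, fun j i l hil => hcon.2 j i l hil⟩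
    refine (measure_mono hcover).trans ((measure_union_le _ _).trans ?_)
    have hzero : P (⋃ j, ⋃ i, ⋃ l, ⋃ _ : i ≠ l,
        {xs : Fin n → ℝ | dist (c j) (xs i) = dist (c j) (xs l)}) = 0 := by
      simp only [measure_iUnion_null_iff]
      exact fun j i l hil => measure_dist_tie_eq_zero μ (c j) hil
    rw [hzero, add_zero]
    have hone (j : Fin m) : P {xs : Fin n → ℝ |
        (Finset.univ.filter fun i => xs i ∈ ball (c j) w).card < k} ≤
          2 ^ k * ENNReal.ofReal (1 - w) ^ n := by
      have h := measure_card_mem_lt_le (ι := Fin n) μ (measurableSet_ball (x := c j) (ε := w)) k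
      rwa [hball, Fintype.card_fin] at h
    calc _ ≤ ∑ j, P {xs : Fin n → ℝ |
          (Finset.univ.filter fun i => xs i ∈ ball (c j) w).card < k} :=
        measure_iUnion_fintype_le _ _
      _ ≤ ∑ _j : Fin m, 2 ^ k * ENNReal.ofReal (1 - w) ^ n := Finset.sum_le_sum fun j _ => hone j
      _ = m * (2 ^ k * ENNReal.ofReal (1 - w) ^ n) := by
        rw [Finset.sum_const, Finset.card_univ, Fintype.card_fin, nsmul_eq_mul]
  have hH : (P.prod P) (((toMeasurable P Gᶜ)ᶜ ×ˢ univ) ∩ majorityFailure k p c) ≤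
      (1 - (2 * ENNReal.ofReal p) ^ k / 4) ^ m := by
    rw [Measure.prod_apply (((measurableSet_toMeasurable _ _).compl.prod .univ).inter
      (measurableSet_majorityFailure k p c))]
    refine (lintegral_mono (g := fun _ => (1 - (2 * ENNReal.ofReal p) ^ k / 4) ^ m)
      fun xs => ?_).trans (by simp)
    by_cases hxs : xs ∈ toMeasurable P Gᶜ
    · simp [hxs]
    · have hxsG : xs ∈ G := by
        by_contra h
        exact hxs (subset_toMeasurable _ _ h)
      exact (measure_mono fun u hu => hu.2).trans
        (measure_majorityFailure_section_le hk hp hp' hdisj hxsG.1 hxsG.2)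
  have hcover : s'ᶜ ⊆ (toMeasurable P Gᶜ ×ˢ univ) ∪
      (((toMeasurable P Gᶜ)ᶜ ×ˢ univ) ∩ majorityFailure k p c) := by
    rintro ⟨xs, u⟩ hq
    by_cases hxs : xs ∈ toMeasurable P Gᶜ
    · exact .inl ⟨hxs, mem_univ _⟩
    refine .inr ⟨⟨hxs, mem_univ _⟩, fun j => ?_⟩
    have hxsG : xs ∈ G := by
      by_contra h
      exact hxs (subset_toMeasurable _ _ h)
    simp only [s', s, mem_compl_iff, mem_ofPred_eq, not_forall, not_exists] at hq
    obtain ⟨f, hf, hfc⟩ := hq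
    obtain ⟨T, hTk, hT, hTf⟩ := hf (c j)
    rw [min_eq_left hkn] at hTk
    refine ⟨T, hTk, hT, fun hpos => hfc j (hTf.2 (hpos.trans_le ?_))⟩
    refine Finset.sum_le_sum fun i hi => labelVal_mono fun h => ?_
    have := (hsub j (nearest_mem_ball hT (hTk.trans_le (hxsG.1 j)) hi)).1
    simp only [decide_eq_true_eq] at h ⊢
    exact h.trans_le this
  rw [tsub_le_iff_left]
  calc (1 : ℝ≥0∞) = (P.prod P) (s'ᶜ ∪ s') := by simp
    _ ≤ (P.prod P) s'ᶜ + (P.prod P) s' := measure_union_le _ _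
    _ ≤ _ := by
      gcongr
      refine (measure_mono hcover).trans ((measure_union_le _ _).trans ?_)
      gcongr
      rw [Measure.prod_prod, measure_toMeasurable, measure_univ, mul_one]
      exact hG

end FailureProbability

section Asymptotics

lemma eventually_le_mul_exp {a b : ℝ} (ha : 0 < a) (hb : 0 < b) :
    ∀ᶠ x : ℝ in atTop, x ≤ a * Real.exp (b * x) := by
  have h := (isLittleO_pow_exp_pos_mul_atTop 1 hb).bound ha
  filter_upwards [h] with x hx
  simpa using (le_abs_self _).trans hx

/-- For `Δ` small in terms of `C`, about `√n` groups of at most `C log n` neighbors suffice for the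
failure probability to drop below one half. -/
lemma exists_failure_bound_le_half (C : ℝ) :
    ∃ Δ : ℝ, 0 < Δ ∧ Δ < 1 / 2 ∧ ∃ N : ℕ, ∀ n ≥ N, ∀ k : ℕ, (k : ℝ) ≤ C * Real.log n →
      k ≤ n ∧ ((n.sqrt + 1 : ℕ) : ℝ) * (2 ^ k * (1 - Δ / (8 * (n.sqrt + 1 : ℕ))) ^ n) +
        (1 - (2 * (1 / 2 - Δ)) ^ k / 4) ^ (n.sqrt + 1) ≤ 1 / 2 := by
  set D := max C 1
  have hD : 1 ≤ D := le_max_right _ _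
  have hexp : Real.exp (-(1 / (4 * D))) < 1 := by
    rw [Real.exp_lt_one_iff]; have : 0 < 1 / (4 * D) := by positivity
    linarith
  set Δ := (1 - Real.exp (-(1 / (4 * D)))) / 2 with hΔ
  have hΔ0 : 0 < Δ := by rw [hΔ]; linarith
  have hΔ1 : Δ < 1 / 2 := by have := Real.exp_pos (-(1 / (4 * D))); rw [hΔ]; linarith
  refine ⟨Δ, hΔ0, hΔ1, ?_⟩
  have hev : ∀ᶠ x : ℝ in atTop, 4 ≤ x ∧ x ≤ 1 / D * Real.exp (1 * x) ∧
      x ≤ Δ / 16 / (5 / 2 + D) * Real.exp (1 / 2 * x) ∧ x ≤ 1 / 4 * Real.exp (1 / 4 * x) :=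
    (eventually_ge_atTop 4).and <| (eventually_le_mul_exp (by positivity) one_pos).and <|
      (eventually_le_mul_exp (by positivity) (by norm_num)).and <|
      eventually_le_mul_exp (by norm_num) (by norm_num)
  obtain ⟨N, hN⟩ := eventually_atTop.1 <|
    (Real.tendsto_log_atTop.comp tendsto_natCast_atTop_atTop).eventually hev
  refine ⟨max N 1, fun n hn k hk => ?_⟩
  have hn1 : 1 ≤ n := (le_max_right _ _).trans hn
  have hn0 : (0 : ℝ) < n := by exact_mod_cast hn1
  obtain ⟨h4, hkn, hfew, hvote⟩ := hN n ((le_max_left _ _).trans hn)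
  simp only [Function.comp_apply] at h4 hkn hfew hvote
  set x := Real.log n with hx
  have hnx : (n : ℝ) = Real.exp x := (Real.exp_log hn0).symm
  have hkD : (k : ℝ) ≤ D * x := hk.trans (by gcongr; exact le_max_left _ _)
  set s := Real.exp (1 / 2 * x) with hs
  have hs0 : 0 < s := Real.exp_pos _
  have hss : s * s = n := by rw [hs, ← Real.exp_add, hnx]; ring_nf
  have hs1 : 1 ≤ s := Real.one_le_exp (by linarith)
  set m := n.sqrt + 1 with hm
  have hms : s ≤ m := by
    have h : (n : ℝ) < m * m := by exact_mod_cast Nat.lt_succ_sqrt n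
    nlinarith
  have hm2 : (m : ℝ) ≤ 2 * s := by
    have h : (n.sqrt : ℝ) * n.sqrt ≤ n := by exact_mod_cast Nat.sqrt_le n
    have : (n.sqrt : ℝ) ≤ s := by nlinarith
    push_cast [hm]; linarith
  have hm0 : (0 : ℝ) < m := hs0.trans_le hms
  constructor
  · have : (k : ℝ) ≤ n := by
      rw [one_mul, div_mul_eq_mul_div, one_mul, le_div_iff₀ (by linarith), ← hnx] at hkn
      linarith
    exact_mod_cast this
  have hbase : 2 * (1 / 2 - Δ) = Real.exp (-(1 / (4 * D))) := by rw [hΔ]; ring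
  have hfew' : (m : ℝ) * (2 ^ k * (1 - Δ / (8 * m)) ^ n) ≤ 1 / 4 := by
    have h2k : (2 : ℝ) ^ k ≤ Real.exp (D * x) := by
      calc (2 : ℝ) ^ k ≤ Real.exp 1 ^ k := by
            gcongr; linarith [Real.add_one_le_exp (1 : ℝ)]
        _ = Real.exp k := by rw [← Real.exp_nat_mul, mul_one]
        _ ≤ _ := Real.exp_le_exp.2 hkD
    have hbase0 : 0 ≤ 1 - Δ / (8 * m) := by
      have : Δ / (8 * m) ≤ 1 := by
        rw [div_le_one (by positivity)]; nlinarith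
      linarith
    have hpow : (1 - Δ / (8 * m)) ^ n ≤ Real.exp (-(Δ / 16 * s)) := by
      calc (1 - Δ / (8 * m)) ^ n ≤ Real.exp (-(Δ / (8 * m))) ^ n := by
            gcongr; exact Real.one_sub_le_exp_neg _
        _ = Real.exp (-(n * (Δ / (8 * m)))) := by rw [← Real.exp_nat_mul]; ring_nf
        _ ≤ _ := by
          refine Real.exp_le_exp.2 (neg_le_neg ?_)
          rw [← hss, mul_div_assoc', le_div_iff₀ (by positivity)]
          nlinarith [mul_pos hΔ0 hs0]
    have hmain : (5 / 2 + D) * x ≤ Δ / 16 * s := by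
      rwa [div_mul_eq_mul_div, le_div_iff₀ (by linarith), mul_comm x] at hfew
    calc (m : ℝ) * (2 ^ k * (1 - Δ / (8 * m)) ^ n)
        ≤ (2 * s) * (Real.exp (D * x) * Real.exp (-(Δ / 16 * s))) := by gcongr
      _ = 2 * Real.exp (1 / 2 * x + D * x - Δ / 16 * s) := by
        rw [sub_eq_add_neg, Real.exp_add, Real.exp_add]; ring
      _ ≤ 2 * Real.exp (-(2 * x)) := by gcongr; linarith
      _ ≤ 1 / 4 := by
        have := Real.add_one_le_exp (2 * x)
        rw [Real.exp_neg, ← div_eq_mul_inv, div_le_div_iff₀ (Real.exp_pos _) (by norm_num)]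
        linarith
  have hvote' : (1 - (2 * (1 / 2 - Δ)) ^ k / 4) ^ m ≤ 1 / 4 := by
    rw [hbase]
    have hle1 : Real.exp (-(1 / (4 * D))) ^ k ≤ 1 := pow_le_one₀ (Real.exp_pos _).le hexp.le
    have hq : Real.exp (-(1 / 4 * x)) ≤ Real.exp (-(1 / (4 * D))) ^ k := by
      rw [← Real.exp_nat_mul, Real.exp_le_exp, mul_neg, neg_le_neg_iff, mul_one_div,
        div_le_iff₀ (by positivity)]
      linarith
    set q := Real.exp (-(1 / (4 * D))) ^ k
    calc (1 - q / 4) ^ m ≤ Real.exp (-(q / 4)) ^ m :=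
          pow_le_pow_left₀ (by linarith) (Real.one_sub_le_exp_neg _) _
      _ = Real.exp (-(m * (q / 4))) := by rw [← Real.exp_nat_mul]; ring_nf
      _ ≤ Real.exp (-x) := by
        refine Real.exp_le_exp.2 (neg_le_neg (hvote.trans ?_))
        have : Real.exp (1 / 4 * x) = s * Real.exp (-(1 / 4 * x)) := by
          rw [hs, ← Real.exp_add]; ring_nf
        rw [this]
        have : s * Real.exp (-(1 / 4 * x)) ≤ m * q := by gcongr
        linarith
      _ ≤ 1 / 4 := by
        have := Real.add_one_le_exp x
        rw [Real.exp_neg, ← one_div, div_le_div_iff₀ (Real.exp_pos _) (by norm_num)]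
        linarith
  linarith

lemma ofReal_failure_bound {m k n : ℕ} {w p : ℝ} (hw : 0 ≤ 1 - w) (hp : 0 ≤ p) (hp' : p ≤ 1 / 2) :
    (m * (2 ^ k * ENNReal.ofReal (1 - w) ^ n) + (1 - (2 * ENNReal.ofReal p) ^ k / 4) ^ m : ℝ≥0∞) =
      ENNReal.ofReal (m * (2 ^ k * (1 - w) ^ n) + (1 - (2 * p) ^ k / 4) ^ m) := by
  have hpow : (2 * p) ^ k ≤ 1 := pow_le_one₀ (by positivity) (by linarith)
  have hvote : 0 ≤ 1 - (2 * p) ^ k / 4 := by linarith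
  rw [ENNReal.ofReal_add (by positivity) (by positivity), ENNReal.ofReal_mul (by positivity),
    ENNReal.ofReal_mul (by positivity), ENNReal.ofReal_pow hw, ENNReal.ofReal_pow hvote,
    ENNReal.ofReal_sub 1 (show 0 ≤ (2 * p) ^ k / 4 by positivity),
    ENNReal.ofReal_div_of_pos (by norm_num), ENNReal.ofReal_pow (by norm_num),
    ENNReal.ofReal_pow (by positivity), ENNReal.ofReal_mul (by norm_num)]
  simp

end Asymptotics

section Statements

open MeasureTheory Metric Set Filter Topology
open scoped ENNReal Classical

/-- for the uniform distribution on `[0,1]` with `η(x) = x` and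
`k_n ≤ C log n`, there is `Δ > 0` such that for large `n`, with probability at least
`1/2`, the learned `k_n`-NN classifier outputs `+1` somewhere in `[1/2 − Δ, 1/2 − 3Δ/4]`. -/
theorem stmt3 (k : ℕ → ℕ) (hk : ∀ n, 0 < k n) (C : ℝ)
    (hC : ∀ n : ℕ, 2 ≤ n → (k n : ℝ) ≤ C * Real.log n) :
    ∃ Δ > (0:ℝ), ∃ N : ℕ, ∀ n ≥ N,
      (1/2 : ℝ≥0∞) ≤ sampleD (volume.restrict (Icc (0:ℝ) 1)) (fun x => x) n
        {S | ∀ f : ℝ → Bool,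
          IsKNNClassifier (k n) (fun j => (S j).1) (fun j => (S j).2) f →
          ∃ x ∈ Icc (1/2 - Δ) (1/2 - 3*Δ/4), f x = true} := by
  obtain ⟨Δ, hΔ0, hΔ1, N, hN⟩ := exists_failure_bound_le_half C
  refine ⟨Δ, hΔ0, max N 2, fun n hn => ?_⟩
  obtain ⟨hkn, hbound⟩ := hN n ((le_max_left _ _).trans hn) (k n) (hC n ((le_max_right _ _).trans hn))
  set m := n.sqrt + 1
  have hm : (0 : ℝ) < m := by positivity
  set w := Δ / (8 * m) with hw
  have hw0 : 0 < w := by positivity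
  have hmw : 8 * (m * w) = Δ := by rw [hw]; field_simp
  have hw1 : 0 ≤ 1 - w := by
    have : (1 : ℝ) ≤ m := by exact_mod_cast Nat.succ_pos _
    nlinarith
  set c : Fin m → ℝ := fun j => 1 / 2 - Δ + (2 * j + 1) * w with hc
  have hjm (j : Fin m) : (2 * (j : ℝ) + 2) * w ≤ Δ / 4 := by
    have : (j : ℝ) + 1 ≤ m := by exact_mod_cast j.isLt
    nlinarith
  have hdisj : Pairwise fun a b => Disjoint (ball (c a) w) (ball (c b) w) := by
    have hlt (a b : Fin m) (hab : a < b) : Disjoint (ball (c a) w) (ball (c b) w) := by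
      have : (a : ℝ) + 1 ≤ b := by exact_mod_cast hab
      refine ball_disjoint_ball ?_
      rw [dist_comm, Real.dist_eq]
      refine le_trans ?_ (le_abs_self _)
      simp only [hc]
      nlinarith
    intro a b hab
    rcases lt_or_gt_of_ne hab with h | h
    · exact hlt a b h
    · exact (hlt b a h).symm
  have hsub (j : Fin m) : ball (c j) w ⊆ Icc (1 / 2 - Δ) 1 := by
    intro y hy
    rw [Real.ball_eq_Ioo] at hy
    have h0 : 0 ≤ (j : ℝ) * w := by positivity
    have := hjm j
    simp only [hc, mem_Ioo] at hy
    constructor <;> linarith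
  have hp : 0 ≤ 1 / 2 - Δ := by linarith
  refine le_trans ?_ <| (le_sampleD_exists_knn_eq_true (hk n) hkn hp (by linarith) hw0.le hdisj
    hsub).trans (measure_mono fun S hS f hf => ?_)
  · rw [ofReal_failure_bound hw1 hp (by linarith)]
    have hhalf : ENNReal.ofReal (1 / 2) = 1 / 2 := by
      rw [ENNReal.ofReal_div_of_pos two_pos]; simp
    calc (1 / 2 : ℝ≥0∞) = 1 - 1 / 2 := by simp [ENNReal.one_sub_inv_two]
      _ ≤ _ := tsub_le_tsub_left (hhalf ▸ ENNReal.ofReal_le_ofReal hbound) 1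
  · obtain ⟨j, hj⟩ := hS f hf
    have h0 : 0 ≤ (j : ℝ) * w := by positivity
    have := hjm j
    refine ⟨c j, ⟨?_, ?_⟩, hj⟩ <;> simp only [hc] <;> linarith

end Statements
end
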